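/- arXiv:1404.1035 — 4 statements merged into one kernel-verified Lean document; each statement's English description precedes it below -/
import Mathlib

section
/- Let g ∈ C²(𝕋) be real-valued. Then the symmetric operator A_g = ½(T_g X + X T_g), defined on the domain of X in ℓ²(ℕ), is essentially self-adjoint, and the span of the canonical basis vectors is a core for its closure. -/
open scoped InnerProductSpace
open Complex

noncomputable section

/-- The `n`-th Fourier coefficient of a `2π`-periodic function `f : ℝ → ℂ`. -/
def fcoef (f : ℝ → ℂ) (n : ℤ) : ℂ :=
  (1 / (2 * Real.pi)) • ∫ θ in (0:ℝ)..(2 * Real.pi), Complex.exp (-Complex.I * n * θ) * f θ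

variable {E : Type*} [NormedAddCommGroup E] [InnerProductSpace ℂ E] [CompleteSpace E]

/-- `e` is the canonical orthonormal (Hilbert) basis of `ℓ²(ℕ)`, abstractly:
an orthonormal family with dense span. -/
def IsONBasis (e : ℕ → E) : Prop :=
  Orthonormal ℂ e ∧ (Submodule.span ℂ (Set.range e)).topologicalClosure = ⊤

/-- `T` is the Toeplitz operator with symbol `f`: `⟪e n, T (e k)⟫ = f̂(n−k)`. -/
def IsToeplitz (e : ℕ → E) (f : ℝ → ℂ) (T : E →L[ℂ] E) : Prop :=
  ∀ n k : ℕ, ⟪e n, T (e k)⟫_ℂ = fcoef f ((n : ℤ) - k)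

/-- `T` is the Hankel operator with symbol `f`: `⟪e n, T (e k)⟫ = f̂(n+k+1)`
(0-based indexing of the paper's `f̂_{n+k-1}`, `n, k ≥ 1`). -/
def IsHankel (e : ℕ → E) (f : ℝ → ℂ) (T : E →L[ℂ] E) : Prop :=
  ∀ n k : ℕ, ⟪e n, T (e k)⟫_ℂ = fcoef f ((n : ℤ) + k + 1)

/-- `X` is the (self-adjoint) position operator: `X e_n = (n+1) e_n` (0-based). -/
def IsPosOp (e : ℕ → E) (X : E →ₗ.[ℂ] E) : Prop :=
  X.adjoint = X ∧ ∀ q : ℕ, ∃ hq : e q ∈ X.domain, X ⟨e q, hq⟩ = ((q : ℂ) + 1) • e q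

/-- `A` is the self-adjoint operator `A_g`, the closure of `½(T_g X + X T_g)`;
being essentially self-adjoint, it is the unique self-adjoint operator with
matrix elements `((p+q+2)/2)·ĝ(p−q)` on the canonical basis (0-based). -/
def IsAg (e : ℕ → E) (g : ℝ → ℂ) (A : E →ₗ.[ℂ] E) : Prop :=
  A.adjoint = A ∧ ∀ q : ℕ, ∃ hq : e q ∈ A.domain, ∀ p : ℕ,
    ⟪e p, A ⟨e q, hq⟩⟫_ℂ = (((p : ℂ) + q + 2) / 2) * fcoef g ((p : ℤ) - q)

/-- `C = ad_A B`: the commutator form of `A` and `B` on `D(A) × D(A)` is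
represented by the bounded operator `C`; in particular `B ∈ C¹(A)`. -/
def CommutatorOf (A : E →ₗ.[ℂ] E) (B C : E →L[ℂ] E) : Prop :=
  ∀ φ ψ : A.domain, ⟪A φ, B (ψ : E)⟫_ℂ - ⟪(φ : E), B (A ψ)⟫_ℂ = ⟪(φ : E), C (ψ : E)⟫_ℂ

open Filter Topology

/-- Piecewise linear cutoff. -/
def cutoff (R n : ℕ) : ℝ := max 0 (1 - (n : ℝ) / R)

lemma cutoff_nonneg (R n : ℕ) : 0 ≤ cutoff R n := le_max_left _ _

lemma cutoff_le_one (R n : ℕ) : cutoff R n ≤ 1 := by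
  unfold cutoff
  apply max_le zero_le_one
  have : (0:ℝ) ≤ (n : ℝ) / R := by positivity
  linarith

lemma cutoff_eq_zero {R n : ℕ} (hR : 0 < R) (h : R ≤ n) : cutoff R n = 0 := by
  unfold cutoff
  apply max_eq_left
  have hR' : (0:ℝ) < R := by exact_mod_cast hR
  have h' : (R:ℝ) ≤ n := by exact_mod_cast h
  have : 1 ≤ (n:ℝ) / R := by rwa [le_div_iff₀ hR', one_mul]
  linarith

lemma cutoff_eq {R n : ℕ} (hR : 0 < R) (h : n ≤ R) : cutoff R n = 1 - (n:ℝ) / R := by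
  unfold cutoff
  apply max_eq_right
  have hR' : (0:ℝ) < R := by exact_mod_cast hR
  have h' : (n:ℝ) ≤ R := by exact_mod_cast h
  have : (n:ℝ) / R ≤ 1 := by rwa [div_le_iff₀ hR', one_mul]
  linarith

lemma cutoff_tendsto (n : ℕ) : Tendsto (fun R => cutoff R n) atTop (𝓝 1) := by
  have h : Tendsto (fun R : ℕ => (n : ℝ) / R) atTop (𝓝 0) :=
    tendsto_const_div_atTop_nhds_zero_nat _
  have h2 := (tendsto_const_nhds (x := (0:ℝ))).max ((tendsto_const_nhds (x := (1:ℝ))).sub h)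
  simpa [cutoff] using h2

lemma cutoff_est_aux {R p q : ℕ} (hR : 0 < R) (hpq : p ≤ q) :
    ((p:ℝ) + q + 2) / 2 * |cutoff R q - cutoff R p| ≤ 2 * ((q:ℝ) - p) := by
  have hR' : (1:ℝ) ≤ R := by exact_mod_cast hR
  have hR0 : (0:ℝ) < R := by linarith
  have h' : (p:ℝ) ≤ q := by exact_mod_cast hpq
  have hp0 : (0:ℝ) ≤ p := by positivity
  rcases le_total R p with h1 | h1
  · rw [cutoff_eq_zero hR h1, cutoff_eq_zero hR (h1.trans hpq)]
    simp only [sub_self, abs_zero, mul_zero]; linarith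
  rcases le_total q R with h2 | h2
  · rw [cutoff_eq hR h1, cutoff_eq hR h2]
    have h2' : (q:ℝ) ≤ R := by exact_mod_cast h2
    have : (1 - (q:ℝ)/R - (1 - (p:ℝ)/R)) = - (((q:ℝ) - p)/R) := by ring
    rw [this, abs_neg, abs_of_nonneg (by apply div_nonneg <;> linarith), ← mul_div_assoc,
      div_le_iff₀ hR0]
    nlinarith
  · rw [cutoff_eq hR h1, cutoff_eq_zero hR h2]
    have h1' : (p:ℝ) ≤ R := by exact_mod_cast h1
    have h2' : (R:ℝ) ≤ q := by exact_mod_cast h2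
    have : (0 - (1 - (p:ℝ)/R)) = - (((R:ℝ) - p)/R) := by field_simp; ring
    rw [this, abs_neg, abs_of_nonneg (by apply div_nonneg <;> linarith), ← mul_div_assoc,
      div_le_iff₀ hR0]
    rcases h1.eq_or_lt with h3 | h3
    · subst h3; nlinarith
    have h3' : (p:ℝ) + 1 ≤ R := by exact_mod_cast h3
    have e1 : (2 * (p:ℝ) + 2) * (R - p) ≤ 2 * R * (q - p) := by
      apply mul_le_mul <;> linarith
    have e2 : ((q:ℝ) - p) * (R - p) ≤ (q - p) * R := by
      apply mul_le_mul_of_nonneg_left <;> linarith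
    nlinarith

lemma cutoff_est {R : ℕ} (p q : ℕ) (hR : 0 < R) :
    ((p:ℝ) + q + 2) / 2 * |cutoff R q - cutoff R p| ≤ 2 * |(((p:ℤ) - q : ℤ) : ℝ)| := by
  push_cast
  rcases le_total p q with h | h
  · refine (cutoff_est_aux hR h).trans ?_
    rw [abs_sub_comm]
    gcongr; exact le_abs_self _
  · have := cutoff_est_aux hR h
    rw [abs_sub_comm, add_comm (p:ℝ)]
    refine this.trans ?_
    gcongr; exact le_abs_self _

lemma young_summable (k : ℤ → ℝ) (hk0 : ∀ d, 0 ≤ k d) (hk : Summable k) (a c : ℕ → ℂ)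
    (ha : Summable fun n => ‖a n‖ ^ 2) (hc : Summable fun n => ‖c n‖ ^ 2) :
    Summable fun x : ℕ × ℕ => k ((x.1 : ℤ) - x.2) * (‖a x.1‖ * ‖c x.2‖) := by
  have h1 : Summable fun x : ℕ × ℕ => ‖a x.1‖ ^ 2 * k ((x.1 : ℤ) - x.2) := by
    have := ha.mul_of_nonneg hk (fun n => by positivity) hk0
    refine this.comp_injective (i := fun x : ℕ × ℕ => (x.1, (x.1 : ℤ) - x.2)) ?_
    rintro ⟨p, q⟩ ⟨p', q'⟩ h
    simp only [Prod.mk.injEq] at h ⊢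
    omega
  have h2 : Summable fun x : ℕ × ℕ => ‖c x.2‖ ^ 2 * k ((x.1 : ℤ) - x.2) := by
    have := hc.mul_of_nonneg hk (fun n => by positivity) hk0
    refine this.comp_injective (i := fun x : ℕ × ℕ => (x.2, (x.1 : ℤ) - x.2)) ?_
    rintro ⟨p, q⟩ ⟨p', q'⟩ h
    simp only [Prod.mk.injEq] at h ⊢
    omega
  refine Summable.of_nonneg_of_le (fun x => mul_nonneg (hk0 _) (by positivity)) (fun x => ?_)
    (h1.add h2)
  have := hk0 ((x.1 : ℤ) - x.2)
  nlinarith [sq_nonneg (‖a x.1‖ - ‖c x.2‖), sq_nonneg (‖a x.1‖ + ‖c x.2‖),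
    mul_nonneg this (sq_nonneg (‖a x.1‖ - ‖c x.2‖)), mul_nonneg this (sq_nonneg (‖a x.1‖)),
    mul_nonneg this (sq_nonneg (‖c x.2‖))]

lemma hasSum_strip (R : ℕ) (f : ℕ → ℕ → ℂ) (hf : ∀ q, R ≤ q → ∀ p, f p q = 0) (U : ℕ → ℂ)
    (hU : ∀ q, HasSum (fun p => f p q) (U q)) :
    HasSum (fun x : ℕ × ℕ => f x.1 x.2) (∑ q ∈ Finset.range R, U q) := by
  have h1 : ∀ q ∈ Finset.range R,
      HasSum (fun x : ℕ × ℕ => if x.2 = q then f x.1 x.2 else 0) (U q) := by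
    intro q _
    have hinj : Function.Injective (fun p : ℕ => (p, q)) := fun p p' h => by simpa using h
    refine (hinj.hasSum_iff ?_).1 ?_
    · rintro ⟨p, q'⟩ hx
      have : q' ≠ q := by
        rintro rfl
        exact hx ⟨p, rfl⟩
      simp [this]
    · simpa [Function.comp_def] using hU q
  have h2 := hasSum_sum h1
  convert h2 using 1
  ext ⟨p, q⟩
  simp only [Finset.sum_ite_eq, Finset.mem_range]
  split_ifs with h
  · rfl
  · exact hf q (not_lt.1 h) p

lemma cutoff_sum_tendsto (f : ℕ → ℂ) (hf : Summable f) :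
    Tendsto (fun R : ℕ => ∑ q ∈ Finset.range R, (cutoff R q : ℂ) * f q) atTop (𝓝 (∑' q, f q)) := by
  have h := tendsto_tsum_of_dominated_convergence (𝓕 := atTop)
    (f := fun (R : ℕ) q => (cutoff R q : ℂ) * f q) (g := f) (bound := fun q => ‖f q‖) hf.norm
    (fun q => ?_) (Eventually.of_forall fun R q => ?_)
  · refine h.congr' ?_
    filter_upwards [eventually_gt_atTop 0] with R hR
    refine tsum_eq_sum fun q hq => ?_
    rw [cutoff_eq_zero hR (by simpa using hq)]; simp
  · have := (Complex.continuous_ofReal.tendsto 1).comp (cutoff_tendsto q)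
    simpa using this.mul_const (f q)
  · rw [norm_mul, Complex.norm_real, Real.norm_of_nonneg (cutoff_nonneg _ _)]
    exact mul_le_of_le_one_left (norm_nonneg _) (cutoff_le_one _ _)

lemma main_lim (b : ℕ → ℕ → ℂ) (a c U V : ℕ → ℂ)
    (hU : ∀ q, HasSum (fun p => a p * b p q) (U q))
    (hV : ∀ p, HasSum (fun q => b p q * c q) (V p))
    (hUc : Summable fun q => U q * c q) (haV : Summable fun p => a p * V p)
    (h : ℤ → ℝ) (hh0 : ∀ d, 0 ≤ h d) (hh : Summable fun d : ℤ => |(d:ℝ)| * h d)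
    (hb : ∀ p q : ℕ, ‖b p q‖ ≤ ((p:ℝ) + q + 2) / 2 * h ((p:ℤ) - q))
    (ha : Summable fun n => ‖a n‖ ^ 2) (hc : Summable fun n => ‖c n‖ ^ 2) :
    ∑' q, U q * c q = ∑' p, a p * V p := by
  have hY := (young_summable (fun d => |(d:ℝ)| * h d)
    (fun d => mul_nonneg (abs_nonneg _) (hh0 d)) hh a c ha hc).mul_left 2
  set F : ℕ → ℕ × ℕ → ℂ := fun R x =>
    ((cutoff R x.2 : ℂ) - cutoff R x.1) * (a x.1 * b x.1 x.2 * c x.2) with hF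
  have hlim : Tendsto (fun R => ∑' x, F R x) atTop (𝓝 0) := by
    have := tendsto_tsum_of_dominated_convergence (𝓕 := atTop) (f := F)
      (g := fun _ => 0) hY (fun x => ?_) ?_
    · simpa using this
    · have h1 := (Complex.continuous_ofReal.tendsto 1).comp (cutoff_tendsto x.1)
      have h2 := (Complex.continuous_ofReal.tendsto 1).comp (cutoff_tendsto x.2)
      simpa using (h2.sub h1).mul_const (a x.1 * b x.1 x.2 * c x.2)
    · filter_upwards [eventually_gt_atTop 0] with R hR x
      have e1 := cutoff_est x.1 x.2 hR
      have e2 := hb x.1 x.2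
      simp only [hF, norm_mul, ← Complex.ofReal_sub, Complex.norm_real, Real.norm_eq_abs]
      calc |cutoff R x.2 - cutoff R x.1| * (‖a x.1‖ * ‖b x.1 x.2‖ * ‖c x.2‖)
          ≤ |cutoff R x.2 - cutoff R x.1| * (‖a x.1‖ *
            (((x.1:ℝ) + x.2 + 2) / 2 * h ((x.1:ℤ) - x.2)) * ‖c x.2‖) := by gcongr
        _ = (((x.1:ℝ) + x.2 + 2) / 2 * |cutoff R x.2 - cutoff R x.1|) *
            (h ((x.1:ℤ) - x.2) * (‖a x.1‖ * ‖c x.2‖)) := by ring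
        _ ≤ (2 * |(((x.1:ℤ) - x.2 : ℤ) : ℝ)|) *
            (h ((x.1:ℤ) - x.2) * (‖a x.1‖ * ‖c x.2‖)) := by
            have := hh0 ((x.1:ℤ) - x.2)
            gcongr
        _ = _ := by ring
  have hS : ∀ R : ℕ, 0 < R → ∑' x, F R x =
      ∑ q ∈ Finset.range R, (cutoff R q : ℂ) * (U q * c q) -
      ∑ p ∈ Finset.range R, (cutoff R p : ℂ) * (a p * V p) := by
    intro R hR
    have s1 := hasSum_strip R (fun p q => (cutoff R q : ℂ) * (a p * b p q * c q))
      (fun q hq p => by simp [cutoff_eq_zero hR hq])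
      (fun q => (cutoff R q : ℂ) * (U q * c q))
      (fun q => ((hU q).mul_right (c q)).mul_left _)
    have s2 := hasSum_strip R (fun q p => (cutoff R p : ℂ) * (a p * b p q * c q))
      (fun q hq p => by simp [cutoff_eq_zero hR hq])
      (fun p => (cutoff R p : ℂ) * (a p * V p))
      (fun p => by
        have := ((hV p).mul_left (a p)).mul_left (cutoff R p : ℂ)
        simpa only [mul_assoc] using this)
    have s2' := (Equiv.prodComm ℕ ℕ).hasSum_iff.2 s2
    have := s1.sub s2'
    rw [← this.tsum_eq]
    refine tsum_congr fun x => ?_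
    simp [hF, sub_mul]
  have l2 := (cutoff_sum_tendsto _ hUc).sub (cutoff_sum_tendsto _ haV)
  have l3 : Tendsto (fun R => ∑' x, F R x) atTop
      (𝓝 (∑' q, U q * c q - ∑' p, a p * V p)) := by
    refine l2.congr' ?_
    filter_upwards [eventually_gt_atTop 0] with R hR
    exact (hS R hR).symm
  exact sub_eq_zero.1 (tendsto_nhds_unique l3 hlim)

lemma two_pi_pos' : (0:ℝ) < 2 * Real.pi := by positivity

lemma fcoef_eq_on (f : ℝ → ℂ) (n : ℤ) : fcoef f n = fourierCoeffOn two_pi_pos' f n := by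
  rw [fourierCoeffOn_eq_integral, fcoef, sub_zero]
  congr 1
  refine intervalIntegral.integral_congr fun x _ => ?_
  simp only [smul_eq_mul]
  rw [fourier_coe_apply]
  congr 2
  have : (Real.pi : ℂ) ≠ 0 := by exact_mod_cast Real.pi_ne_zero
  push_cast
  field_simp

lemma fcoef_conj (g : ℝ → ℝ) (n : ℤ) :
    (starRingEnd ℂ) (fcoef (fun x => (g x : ℂ)) n) = fcoef (fun x => (g x : ℂ)) (-n) := by
  unfold fcoef
  rw [intervalIntegral.integral_of_le two_pi_pos'.le, intervalIntegral.integral_of_le two_pi_pos'.le,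
    Complex.real_smul, Complex.real_smul, map_mul, Complex.conj_ofReal, ← integral_conj]
  congr 2
  ext x
  rw [map_mul, Complex.conj_ofReal, ← Complex.exp_conj]
  simp

lemma fcoef_deriv (f f' : ℝ → ℂ) (hf : ∀ x, HasDerivAt f (f' x) x) (hf' : Continuous f')
    (hp : f (2 * Real.pi) = f 0) (n : ℤ) (hn : n ≠ 0) :
    ‖fcoef f n‖ = ‖fcoef f' n‖ / |(n:ℝ)| := by
  rw [fcoef_eq_on, fcoef_eq_on, fourierCoeffOn_of_hasDerivAt two_pi_pos' hn (fun x _ => hf x)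
    (hf'.intervalIntegrable _ _), hp]
  have hpi := Real.pi_pos
  have hn' : |(n:ℝ)| ≠ 0 := by simpa using hn
  simp [abs_of_pos hpi]
  field_simp

lemma fcoef_summable (g : ℝ → ℝ) (hg : ContDiff ℝ 2 g)
    (hgp : Function.Periodic g (2 * Real.pi)) :
    Summable fun d : ℤ => |(d:ℝ)| * ‖fcoef (fun x => (g x : ℂ)) d‖ := by
  have hd1 : ContDiff ℝ 1 (deriv g) := by
    have := (contDiff_succ_iff_deriv (n := 1) (f := g)).1 (by simpa [one_add_one_eq_two] using hg)
    exact this.2.2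
  have hd2 : Continuous (deriv (deriv g)) := hd1.continuous_deriv le_rfl
  have h1 : ∀ x, HasDerivAt (fun x => (g x : ℂ)) ((deriv g x : ℝ) : ℂ) x := fun x =>
    ((hg.differentiable (by norm_num) x).hasDerivAt).ofReal_comp
  have h2 : ∀ x, HasDerivAt (fun x => ((deriv g x : ℝ) : ℂ)) ((deriv (deriv g) x : ℝ) : ℂ) x := fun x =>
    ((hd1.differentiable (by norm_num) x).hasDerivAt).ofReal_comp
  have hp' : deriv g (2 * Real.pi) = deriv g 0 := by
    have : (fun x => g (x + 2 * Real.pi)) = g := funext hgp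
    have h3 := deriv_comp_add_const g (2 * Real.pi) 0
    rw [this] at h3
    simpa using h3.symm
  have c2 : Continuous fun x => ((deriv (deriv g) x : ℝ) : ℂ) := Complex.continuous_ofReal.comp hd2
  have hL : MeasureTheory.MemLp (fun x => ((deriv (deriv g) x : ℝ) : ℂ)) 2
      (MeasureTheory.volume.restrict (Set.Ioc 0 (2 * Real.pi))) := by
    obtain ⟨C, hC⟩ := (isCompact_Icc (a := (0:ℝ)) (b := 2 * Real.pi)).exists_bound_of_continuousOn
      c2.continuousOn
    refine MeasureTheory.MemLp.of_bound c2.aestronglyMeasurable C ?_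
    refine (MeasureTheory.ae_restrict_mem measurableSet_Ioc).mono fun x hx => ?_
    exact hC x (Set.Ioc_subset_Icc_self hx)
  have s1 := (hasSum_sq_fourierCoeffOn two_pi_pos' hL).summable
  have s2 : Summable fun d : ℤ => 1 / (d:ℝ) ^ 2 := Real.summable_one_div_int_pow.2 (by norm_num)
  refine Summable.of_nonneg_of_le (fun d => by positivity) (fun d => ?_) (s1.add s2)
  rw [← fcoef_eq_on]
  rcases eq_or_ne d 0 with rfl | hd
  · simp
  rw [fcoef_deriv _ _ h1 (Complex.continuous_ofReal.comp hd1.continuous)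
    (by simpa using hgp 0) d hd, fcoef_deriv _ _ h2 c2 (by rw [hp']) d hd]
  have hd' : 0 < |(d:ℝ)| := by positivity
  set t := ‖fcoef (fun x => ((deriv (deriv g) x : ℝ) : ℂ)) d‖
  have : |(d:ℝ)| * (t / |(d:ℝ)| / |(d:ℝ)|) = t * (1 / |(d:ℝ)|) := by field_simp
  rw [this, ← sq_abs (d:ℝ)]
  have : 1 / |(d:ℝ)| ^ 2 = (1 / |(d:ℝ)|) ^ 2 := by ring
  rw [this]
  nlinarith [sq_nonneg (t - 1 / |(d:ℝ)|), sq_nonneg t, sq_nonneg (1 / |(d:ℝ)|)]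

lemma formal_mono {A B C : E →ₗ.[ℂ] E} (hBA : B ≤ A) (h : A.IsFormalAdjoint C) :
    B.IsFormalAdjoint C := by
  intro x y
  have hx : (x : E) ∈ A.domain := hBA.1 x.2
  have := h ⟨x, hx⟩ y
  rwa [← hBA.2 (x := x) (y := ⟨x, hx⟩) rfl] at this

lemma adjoint_anti {A B : E →ₗ.[ℂ] E} (hB : Dense (B.domain : Set E)) (hBA : B ≤ A) :
    A.adjoint ≤ B.adjoint := by
  have hA : Dense (A.domain : Set E) := hB.mono hBA.1
  exact (formal_mono hBA (LinearPMap.adjoint_isFormalAdjoint hA).symm).le_adjoint hB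

lemma ess_of {A B : E →ₗ.[ℂ] E} (hB : Dense (B.domain : Set E)) (hBA : B ≤ A)
    (hA : A.IsFormalAdjoint A) (hBs : B.adjoint.IsFormalAdjoint B.adjoint) :
    A.adjoint.adjoint = A.adjoint ∧ B.adjoint.adjoint = A.adjoint.adjoint := by
  have hAd : Dense (A.domain : Set E) := hB.mono hBA.1
  have h1 : A ≤ A.adjoint := hA.le_adjoint hAd
  have h2 : A.adjoint.adjoint ≤ A.adjoint := adjoint_anti hAd h1
  have h3 : A.adjoint ≤ B.adjoint := adjoint_anti hB hBA
  have hAd' : Dense (A.adjoint.domain : Set E) := hAd.mono h1.1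
  have hBd' : Dense (B.adjoint.domain : Set E) := hAd'.mono h3.1
  have h4 : B.adjoint.adjoint ≤ A.adjoint.adjoint := adjoint_anti hAd' h3
  have h5 : B.adjoint ≤ B.adjoint.adjoint := hBs.le_adjoint hBd'
  have h6 : A.adjoint.adjoint = A.adjoint := le_antisymm h2 (h3.trans (h5.trans h4))
  exact ⟨h6, le_antisymm h4 (h2.trans (h3.trans h5))⟩

lemma ext_inner_left_basis_aux {e : ℕ → E}
    (hPars : ∀ x y : E, HasSum (fun i => ⟪x, e i⟫_ℂ * ⟪e i, y⟫_ℂ) ⟪x, y⟫_ℂ) {x y : E}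
    (h : ∀ q, ⟪e q, x⟫_ℂ = ⟪e q, y⟫_ℂ) : x = y := by
  refine ext_inner_left ℂ fun v => ?_
  refine (hPars v x).unique ?_
  simpa only [h] using hPars v y

/-- For real-valued `g ∈ C²(𝕋)`, the symmetric operator
`A = ½(T_g X + X T_g)` on `D(X)` is essentially self-adjoint (`A** = A*`), and
the span of the canonical basis is a core for its closure `A**`. -/
theorem stmt_3 (e : ℕ → E) (he : IsONBasis e)
    (g : ℝ → ℝ) (hg : ContDiff ℝ 2 g) (hgp : Function.Periodic g (2 * Real.pi))
    (X : E →ₗ.[ℂ] E) (hX : IsPosOp e X)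
    (Tg : E →L[ℂ] E) (hTg : IsToeplitz e (fun x => Complex.ofReal (g x)) Tg)
    (A : E →ₗ.[ℂ] E) (hdom : A.domain = X.domain)
    (hA : ∀ (ψ : E) (h1 : ψ ∈ A.domain) (h2 : ψ ∈ X.domain) (n : ℕ),
      ⟪e n, A ⟨ψ, h1⟩⟫_ℂ = (1 / 2) *
        (⟪(ContinuousLinearMap.adjoint Tg) (e n), X ⟨ψ, h2⟩⟫_ℂ +
          ((n : ℂ) + 1) * ⟪e n, Tg ψ⟫_ℂ)) :
    A.adjoint.adjoint = A.adjoint ∧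
      (A.domRestrict (Submodule.span ℂ (Set.range e))).adjoint.adjoint = A.adjoint.adjoint := by
  obtain ⟨hon, hspan⟩ := he
  let bs : HilbertBasis ℕ ℂ E := HilbertBasis.mk hon hspan.ge
  have hbs : ∀ n, bs n = e n := fun n => by simp [bs]
  have hPars : ∀ x y : E, HasSum (fun i => ⟪x, e i⟫_ℂ * ⟪e i, y⟫_ℂ) ⟪x, y⟫_ℂ := fun x y => by
    simpa only [hbs] using bs.hasSum_inner_mul_inner x y
  have hspanD : Dense ((Submodule.span ℂ (Set.range e) : Submodule ℂ E) : Set E) :=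
    (Submodule.dense_iff_topologicalClosure_eq_top).2 hspan
  obtain ⟨hXadj, hXe⟩ := hX
  have heX : ∀ q, e q ∈ X.domain := fun q => (hXe q).1
  have heA : ∀ q, e q ∈ A.domain := fun q => hdom ▸ heX q
  have hXval : ∀ q, X ⟨e q, heX q⟩ = ((q : ℂ) + 1) • e q := fun q => (hXe q).2
  have hsX : Submodule.span ℂ (Set.range e) ≤ X.domain :=
    Submodule.span_le.2 (by rintro _ ⟨q, rfl⟩; exact heX q)
  have hXd : Dense (X.domain : Set E) := hspanD.mono hsX
  have hXs : X.IsFormalAdjoint X := by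
    have := LinearPMap.adjoint_isFormalAdjoint hXd
    rwa [hXadj] at this
  -- `Tg` is symmetric
  have hTconj : ∀ p q : ℕ, ⟪Tg (e p), e q⟫_ℂ = ⟪e p, Tg (e q)⟫_ℂ := fun p q => by
    rw [← inner_conj_symm, hTg, hTg, fcoef_conj, neg_sub]
  have hT1 : ∀ p : ℕ, ContinuousLinearMap.adjoint Tg (e p) = Tg (e p) := fun p => by
    refine ext_inner_left_basis_aux (e := e) hPars fun q => ?_
    rw [ContinuousLinearMap.adjoint_inner_right, hTconj]
  have hT : ∀ x y : E, ⟪Tg x, y⟫_ℂ = ⟪x, Tg y⟫_ℂ := fun x y => by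
    rw [← ContinuousLinearMap.adjoint_inner_right]
    have : ContinuousLinearMap.adjoint Tg y = Tg y := by
      refine ext_inner_left_basis_aux (e := e) hPars fun q => ?_
      rw [ContinuousLinearMap.adjoint_inner_right, ← hT1 q, ContinuousLinearMap.adjoint_inner_left]
    rw [this]
  -- `A` is symmetric
  have hAform : ∀ (φ ψ : A.domain) (h1 : (φ : E) ∈ X.domain) (h2 : (ψ : E) ∈ X.domain),
      ⟪(φ : E), A ψ⟫_ℂ = (1 / 2) * (⟪(φ : E), Tg (X ⟨ψ, h2⟩)⟫_ℂ + ⟪X ⟨φ, h1⟩, Tg ψ⟫_ℂ) := by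
    intro φ ψ h1 h2
    have s1 := (hPars φ (Tg (X ⟨ψ, h2⟩))).add (hPars (X ⟨φ, h1⟩) (Tg ψ))
    refine (hPars φ (A ψ)).unique ?_
    suffices hfun : (fun i => ⟪(φ : E), e i⟫_ℂ * ⟪e i, A ψ⟫_ℂ) = fun i => (1 / 2 : ℂ) *
        (⟪(φ : E), e i⟫_ℂ * ⟪e i, Tg (X ⟨ψ, h2⟩)⟫_ℂ + ⟪X ⟨φ, h1⟩, e i⟫_ℂ * ⟪e i, Tg ψ⟫_ℂ) by
      rw [hfun]
      exact s1.mul_left (1 / 2 : ℂ)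
    ext n
    have hx : ⟪X ⟨φ, h1⟩, e n⟫_ℂ = ((n : ℂ) + 1) * ⟪(φ : E), e n⟫_ℂ := by
      have := hXs ⟨φ, h1⟩ ⟨e n, heX n⟩
      rw [hXval, inner_smul_right] at this
      exact this
    have ha := hA ψ ψ.2 h2 n
    rw [ContinuousLinearMap.adjoint_inner_left] at ha
    rw [hx]
    change ⟪(φ : E), e n⟫_ℂ * ⟪e n, A ⟨ψ, ψ.2⟩⟫_ℂ = _
    rw [ha]; ring
  have hAs : A.IsFormalAdjoint A := by
    intro φ ψ
    have h1 : (φ : E) ∈ X.domain := hdom ▸ φ.2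
    have h2 : (ψ : E) ∈ X.domain := hdom ▸ ψ.2
    rw [hAform φ ψ h1 h2, ← inner_conj_symm, hAform ψ φ h2 h1]
    simp only [map_mul, map_add, inner_conj_symm, hT]
    simp only [map_div₀, map_one, map_ofNat]
    ring
  -- matrix elements
  have hmat : ∀ p q : ℕ, ⟪e p, A ⟨e q, heA q⟩⟫_ℂ =
      (((p : ℂ) + q + 2) / 2) * fcoef (fun x => (g x : ℂ)) ((p : ℤ) - q) := fun p q => by
    rw [hA (e q) (heA q) (heX q) p, hXval, inner_smul_right,
      ContinuousLinearMap.adjoint_inner_left, hTg]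
    ring
  have hsA : Submodule.span ℂ (Set.range e) ≤ A.domain := hdom ▸ hsX
  have hBd : Dense ((A.domRestrict (Submodule.span ℂ (Set.range e))).domain : Set E) := by
    rw [LinearPMap.domRestrict_domain, inf_eq_left.2 hsA]
    exact hspanD
  refine ess_of hBd LinearPMap.domRestrict_le hAs ?_
  set B := A.domRestrict (Submodule.span ℂ (Set.range e)) with hBdef
  have heB : ∀ q, e q ∈ B.domain := fun q => ⟨Submodule.subset_span ⟨q, rfl⟩, heA q⟩
  have hBe : ∀ q, B ⟨e q, heB q⟩ = A ⟨e q, heA q⟩ := fun q => LinearPMap.domRestrict_apply rfl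
  have hBadj := LinearPMap.adjoint_isFormalAdjoint hBd
  intro φ ψ
  have key := main_lim (fun p q => ⟪e p, A ⟨e q, heA q⟩⟫_ℂ)
    (fun p => ⟪(φ : E), e p⟫_ℂ) (fun q => ⟪e q, (ψ : E)⟫_ℂ)
    (fun q => ⟪B.adjoint φ, e q⟫_ℂ) (fun p => ⟪e p, B.adjoint ψ⟫_ℂ)
    (fun q => by
      have := hBadj φ ⟨e q, heB q⟩
      rw [hBe] at this
      change ⟪B.adjoint φ, e q⟫_ℂ = _ at this
      rw [this]
      exact hPars _ _)
    (fun p => by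
      have := hBadj.symm ⟨e p, heB p⟩ ψ
      rw [hBe] at this
      change _ = ⟪e p, B.adjoint ψ⟫_ℂ at this
      rw [← this]
      convert hPars (A ⟨e p, heA p⟩) (ψ : E) using 1
      ext q
      congr 1
      exact (hAs ⟨e p, heA p⟩ ⟨e q, heA q⟩).symm)
    (hPars _ _).summable (hPars _ _).summable
    (fun d => ‖fcoef (fun x => (g x : ℂ)) d‖) (fun d => norm_nonneg _) (fcoef_summable g hg hgp)
    (fun p q => by
      rw [hmat, norm_mul]
      refine le_of_eq ?_
      congr 1
      have : ((p : ℂ) + q + 2) / 2 = (((((p:ℝ) + q + 2) / 2 : ℝ)) : ℂ) := by push_cast; ring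
      rw [this, Complex.norm_real, Real.norm_of_nonneg (by positivity)])
    (by
      simp only [norm_inner_symm (φ : E)]
      exact hon.inner_products_summable (φ : E))
    (hon.inner_products_summable (ψ : E))
  rw [(hPars _ _).tsum_eq, (hPars _ _).tsum_eq] at key
  exact key
end
end

section
/- Let g ∈ C²(𝕋) be real-valued and A_g the self-adjoint closure of ½(T_g X + X T_g) on ℓ²(ℕ). Then the operators A_g X^{−1} and A_g² X^{−2} are bounded. -/
open scoped InnerProductSpace
open Complex

noncomputable section

variable {E : Type*} [NormedAddCommGroup E] [InnerProductSpace ℂ E] [CompleteSpace E]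

theorem aux_dense {e : ℕ → E} (he : IsONBasis e) :
    Dense ((Submodule.span ℂ (Set.range e) : Submodule ℂ E) : Set E) :=
  Submodule.dense_iff_topologicalClosure_eq_top.mpr he.2

theorem aux_ext {e : ℕ → E} (he : IsONBasis e) {x y : E}
    (h : ∀ p, ⟪e p, x⟫_ℂ = ⟪e p, y⟫_ℂ) : x = y := by
  have hd := aux_dense he
  refine hd.eq_of_inner_right (𝕜 := ℂ) ?_
  intro v hv
  induction hv using Submodule.span_induction with
  | mem z hz => obtain ⟨p, rfl⟩ := hz; exact h p
  | zero => simp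
  | add a b _ _ ha hb => simp [inner_add_left, ha, hb]
  | smul c a _ ha => simp [inner_smul_left, ha]

theorem aux_inner {e : ℕ → E} (he : IsONBasis e) (p q : ℕ) :
    ⟪e p, e q⟫_ℂ = if p = q then 1 else 0 := orthonormal_iff_ite.mp he.1 p q

/-- vector with given square summable coefficients -/
theorem aux_vec {e : ℕ → E} (he : IsONBasis e) (a : ℕ → ℂ) (ha : Summable fun p => ‖a p‖ ^ 2) :
    ∃ v : E, (∀ p, ⟪e p, v⟫_ℂ = a p) ∧ ‖v‖ ^ 2 = ∑' p, ‖a p‖ ^ 2 := by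
  let b := HilbertBasis.mk he.1 he.2.ge
  have hb : ⇑b = e := HilbertBasis.coe_mk _ _
  have hm : Memℓp a 2 := by
    refine memℓp_gen ?_
    simpa using ha
  let f : lp (fun _ : ℕ => ℂ) 2 := ⟨a, hm⟩
  refine ⟨b.repr.symm f, fun p => ?_, ?_⟩
  · rw [← hb, ← b.repr_apply_apply, LinearIsometryEquiv.apply_symm_apply]
  · rw [LinearIsometryEquiv.norm_map]
    have := lp.norm_rpow_eq_tsum (p := 2) (by simp) f
    simpa using this

/-- shift operators -/
theorem aux_shift {e : ℕ → E} (he : IsONBasis e) (n : ℕ) :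
    ∃ V : E →L[ℂ] E, ‖V‖ ≤ 1 ∧ ∀ q, V (e q) = e (q + n) := by
  let b := HilbertBasis.mk he.1 he.2.ge
  have hb : ⇑b = e := HilbertBasis.coe_mk _ _
  have ho : Orthonormal ℂ (fun q => e (q + n)) := he.1.comp _ (add_left_injective n)
  let V := ho.orthogonalFamily.linearIsometry.comp b.repr.toLinearIsometry
  refine ⟨V.toContinuousLinearMap, V.norm_toContinuousLinearMap_le, fun q => ?_⟩
  have : b.repr (e q) = lp.single 2 q (1 : ℂ) := by rw [← hb, b.repr_self]
  change ho.orthogonalFamily.linearIsometry (b.repr (e q)) = _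
  rw [this]
  refine (ho.orthogonalFamily.linearIsometry_apply_single (i := q) (1 : ℂ)).trans ?_
  simp

theorem aux_shiftZ {e : ℕ → E} (he : IsONBasis e) (d : ℤ) :
    ∃ V : E →L[ℂ] E, ‖V‖ ≤ 1 ∧
      ∀ p q : ℕ, ⟪e p, V (e q)⟫_ℂ = if (p : ℤ) - q = d then 1 else 0 := by
  obtain ⟨n, rfl | rfl⟩ := Int.eq_nat_or_neg d
  · obtain ⟨V, h1, h2⟩ := aux_shift he n
    refine ⟨V, h1, fun p q => ?_⟩
    rw [h2, aux_inner he]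
    exact if_congr (by omega) rfl rfl
  · obtain ⟨V, h1, h2⟩ := aux_shift he n
    refine ⟨ContinuousLinearMap.adjoint V, by simpa using h1, fun p q => ?_⟩
    rw [ContinuousLinearMap.adjoint_inner_right, h2, aux_inner he]
    exact if_congr (by omega) rfl rfl

/-- Toeplitz operator with summable coefficients -/
theorem aux_toep {e : ℕ → E} (he : IsONBasis e) (c : ℤ → ℂ) (hc : Summable fun d => ‖c d‖) :
    ∃ T : E →L[ℂ] E, ∀ p q : ℕ, ⟪e p, T (e q)⟫_ℂ = c ((p : ℤ) - q) := by
  choose S hS1 hS2 using aux_shiftZ he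
  have hs : Summable fun d => c d • S d := by
    refine Summable.of_norm_bounded hc fun d => ?_
    rw [norm_smul]
    exact mul_le_of_le_one_right (norm_nonneg _) (hS1 d)
  refine ⟨∑' d, c d • S d, fun p q => ?_⟩
  let L : (E →L[ℂ] E) →L[ℂ] ℂ := (innerSL ℂ (e p)).comp (ContinuousLinearMap.apply ℂ E (e q))
  have h1 : ∀ T : E →L[ℂ] E, ⟪e p, T (e q)⟫_ℂ = L T := fun T => by simp [L]
  rw [h1, L.map_tsum hs, tsum_eq_single ((p : ℤ) - q)]
  · rw [map_smul, ← h1, hS2]; simp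
  · intro d hd
    rw [map_smul, ← h1, hS2, if_neg (Ne.symm hd)]; simp

/-- Toeplitz matrix with ℓ² coefficients times X⁻² -/
theorem aux_toep2 {e : ℕ → E} (he : IsONBasis e) (c : ℤ → ℂ)
    (hc : Summable fun d => ‖c d‖ ^ 2) :
    ∃ T : E →L[ℂ] E, ∀ p q : ℕ,
      ⟪e p, T (e q)⟫_ℂ = (((q : ℂ) + 1) ^ 2)⁻¹ * c ((p : ℤ) - q) := by
  have hinj : ∀ q : ℕ, Function.Injective fun p : ℕ => (p : ℤ) - q := fun q a b h => by
    simpa using h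
  have hcol : ∀ q : ℕ, Summable fun p : ℕ => ‖c ((p : ℤ) - q)‖ ^ 2 := fun q =>
    hc.comp_injective (hinj q)
  choose v hv1 hv2 using fun q : ℕ => aux_vec he (fun p : ℕ => c ((p : ℤ) - q)) (hcol q)
  set K := ∑' d, ‖c d‖ ^ 2
  have hK : ∀ q, ‖v q‖ ≤ Real.sqrt K := fun q => by
    refine Real.le_sqrt_of_sq_le ?_
    rw [hv2]
    exact (hcol q).tsum_le_tsum_of_inj _ (hinj q) (fun _ _ => by positivity) (fun _ => le_rfl) hc
  let R : ℕ → E →L[ℂ] E := fun q =>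
    (((q : ℂ) + 1) ^ 2)⁻¹ • (innerSL ℂ (e q)).smulRight (v q)
  have hs : Summable R := by
    have h0 : Summable fun q : ℕ => (((q : ℝ) + 1) ^ 2)⁻¹ * Real.sqrt K := by
      refine Summable.mul_right _ ?_
      have := (summable_nat_add_iff 1).mpr (Real.summable_nat_pow_inv.mpr (by norm_num : 1 < 2))
      simpa using this
    refine Summable.of_norm_bounded h0 fun q => ?_
    have hn : ‖((q : ℂ) + 1)‖ = (q : ℝ) + 1 := by
      have : ((q : ℂ) + 1) = ((q + 1 : ℕ) : ℂ) := by push_cast; rfl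
      rw [this, Complex.norm_natCast]; push_cast; rfl
    simp only [R]
    rw [norm_smul, norm_inv, norm_pow, hn, ContinuousLinearMap.norm_smulRight_apply,
      innerSL_apply_norm, he.1.1 q, one_mul]
    exact mul_le_mul_of_nonneg_left (hK q) (by positivity)
  refine ⟨∑' q, R q, fun p q => ?_⟩
  let L : (E →L[ℂ] E) →L[ℂ] ℂ := (innerSL ℂ (e p)).comp (ContinuousLinearMap.apply ℂ E (e q))
  have h1 : ∀ T : E →L[ℂ] E, ⟪e p, T (e q)⟫_ℂ = L T := fun T => by simp [L]
  rw [h1, L.map_tsum hs, tsum_eq_single q]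
  · rw [← h1]
    simp [R, he.1.1 q, hv1]
  · intro d hd
    rw [← h1]
    simp [R, aux_inner he, inner_smul_right, hd]

theorem aux_fcoef (f : ℝ → ℂ) (n : ℤ) :
    fcoef f n = fourierCoeffOn Real.two_pi_pos f n := by
  rw [fourierCoeffOn_eq_integral, fcoef, sub_zero]
  congr 1
  refine intervalIntegral.integral_congr fun x _ => ?_
  simp only [smul_eq_mul]
  rw [fourier_coe_apply]
  congr 2
  have : (Real.pi : ℂ) ≠ 0 := by exact_mod_cast Real.pi_ne_zero
  push_cast
  field_simp

theorem aux_deriv (f f' : ℝ → ℂ) (hf : ∀ x, HasDerivAt f (f' x) x) (hc : Continuous f')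
    (hp : f (2 * Real.pi) = f 0) (n : ℤ) : (n : ℂ) * fcoef f n = -I * fcoef f' n := by
  by_cases hn : n = 0
  · subst hn
    have : ∫ θ in (0:ℝ)..(2 * Real.pi), f' θ = f (2 * Real.pi) - f 0 :=
      intervalIntegral.integral_eq_sub_of_hasDerivAt (fun x _ => hf x)
        (hc.intervalIntegrable _ _)
    simp [fcoef, this, hp]
  · have := fourierCoeffOn_of_hasDerivAt Real.two_pi_pos hn (fun x _ => hf x)
      (hc.intervalIntegrable _ _)
    rw [aux_fcoef, aux_fcoef, this, hp]
    have h1 : (Real.pi : ℂ) ≠ 0 := by exact_mod_cast Real.pi_ne_zero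
    have h2 : (n : ℂ) ≠ 0 := by exact_mod_cast hn
    push_cast
    field_simp
    simp

theorem aux_bessel (f : ℝ → ℂ) (hc : Continuous f) : Summable fun n => ‖fcoef f n‖ ^ 2 := by
  simp only [aux_fcoef]
  refine (hasSum_sq_fourierCoeffOn Real.two_pi_pos ?_).summable
  obtain ⟨C, hC⟩ := isCompact_Icc.exists_bound_of_continuousOn
    (hc.continuousOn (s := Set.Icc 0 (2 * Real.pi)))
  refine MeasureTheory.MemLp.of_bound hc.aestronglyMeasurable C ?_
  filter_upwards [MeasureTheory.ae_restrict_mem measurableSet_Ioc] with x hx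
  exact hC x (Set.Ioc_subset_Icc_self hx)

theorem aux_g (g : ℝ → ℝ) (hg : ContDiff ℝ 2 g) (hgp : Function.Periodic g (2 * Real.pi)) :
    Summable fun n : ℤ => ‖(n : ℂ) ^ 2 * fcoef (fun x => Complex.ofReal (g x)) n‖ ^ 2 := by
  have hg1 : ContDiff ℝ 1 (deriv g) := hg.deriv' 
  have hg2 : Continuous (deriv (deriv g)) := hg1.continuous_deriv le_rfl
  have e1 := aux_deriv (fun x => (g x : ℂ)) (fun x => ((deriv g x : ℝ) : ℂ))
    (fun x => ((hg.differentiable (by norm_num)) x).hasDerivAt.ofReal_comp)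
    (Complex.continuous_ofReal.comp hg1.continuous) (by simpa using hgp 0)
  have hgp' : deriv g (2 * Real.pi) = deriv g 0 := by
    have : (fun x => g (x + 2 * Real.pi)) = g := funext hgp
    have h2 := deriv_comp_add_const (f := g) (a := 2 * Real.pi) 0
    rw [this] at h2
    simpa using h2.symm
  have e2 := aux_deriv (fun x => ((deriv g x : ℝ) : ℂ)) (fun x => ((deriv (deriv g) x : ℝ) : ℂ))
    (fun x => ((hg1.differentiable (by norm_num)) x).hasDerivAt.ofReal_comp)
    (Complex.continuous_ofReal.comp hg2) (by simpa using hgp')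
  refine (aux_bessel (fun x => ((deriv (deriv g) x : ℝ) : ℂ))
    (Complex.continuous_ofReal.comp hg2)).congr fun n => ?_
  rw [pow_two (n : ℂ), mul_assoc, e1 n, mul_left_comm, e2 n]
  simp

theorem aux_l1 (c : ℤ → ℂ) (hc : Summable fun n : ℤ => ‖(n : ℂ) ^ 2 * c n‖ ^ 2) :
    Summable (fun n : ℤ => ‖c n‖) ∧ Summable (fun n : ℤ => ‖(n : ℂ) * c n‖) := by
  have h2 : Summable fun n : ℤ => 1 / (n : ℝ) ^ 2 :=
    Real.summable_one_div_int_pow.mpr (by norm_num)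
  have h0 : Summable fun n : ℤ => if n = 0 then ‖c 0‖ else 0 :=
    (hasSum_ite_eq (0 : ℤ) ‖c 0‖).summable
  have h3 := (hc.add h2).add h0
  have key : ∀ n : ℤ, n ≠ 0 → ‖(n : ℂ) * c n‖ ≤ ‖(n : ℂ) ^ 2 * c n‖ ^ 2 + 1 / (n : ℝ) ^ 2 := by
    intro n hn
    have hn' : (0:ℝ) < |(n : ℝ)| := by positivity
    rw [norm_mul, norm_mul, norm_pow, Complex.norm_intCast, ← sq_abs (n : ℝ)]
    set a := |(n : ℝ)|
    set t := ‖c n‖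
    have : a * t = (a ^ 2 * t) * (1 / a) := by field_simp
    rw [this]
    have h4 : 1 / a ^ 2 = (1 / a) ^ 2 := by field_simp
    rw [h4]
    nlinarith [sq_nonneg (a ^ 2 * t - 1 / a), sq_nonneg (a ^ 2 * t), sq_nonneg (1 / a)]
  constructor
  · refine h3.of_nonneg_of_le (fun _ => norm_nonneg _) fun n => ?_
    by_cases hn : n = 0
    · subst hn; simp
    · simp only [hn, if_false, add_zero]
      refine le_trans ?_ (key n hn)
      rw [norm_mul, Complex.norm_intCast]
      refine le_mul_of_one_le_left (norm_nonneg _) ?_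
      exact_mod_cast Int.one_le_abs hn
  · refine h3.of_nonneg_of_le (fun _ => norm_nonneg _) fun n => ?_
    by_cases hn : n = 0
    · subst hn; simp
    · simp only [hn, if_false, add_zero]
      exact key n hn

theorem aux_main {e : ℕ → E} (he : IsONBasis e) (c : ℤ → ℂ)
    (hc : Summable fun n : ℤ => ‖(n : ℂ) ^ 2 * c n‖ ^ 2)
    (A : E →ₗ.[ℂ] E) (hA : A.adjoint = A) (hdom : ∀ q, e q ∈ A.domain)
    (hAe : ∀ p q : ℕ, ⟪e p, A ⟨e q, hdom q⟩⟫_ℂ = (((p : ℂ) + q + 2) / 2) * c ((p : ℤ) - q))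
    (Xinv : E →L[ℂ] E) (hXinv : ∀ n : ℕ, Xinv (e n) = (((n : ℂ) + 1)⁻¹) • e n) :
    ∃ B D : E →L[ℂ] E, (∀ ψ, (Xinv ψ, B ψ) ∈ A.graph) ∧ ∀ ψ, Xinv (D ψ) = B (Xinv ψ) := by
  obtain ⟨hc0, hc1⟩ := aux_l1 c hc
  obtain ⟨T0, hT0⟩ := aux_toep he c hc0
  obtain ⟨T1, hT1⟩ := aux_toep he _ hc1
  obtain ⟨T2, hT2⟩ := aux_toep2 he _ hc
  have hd := aux_dense he
  have hAd : Dense (A.domain : Set E) :=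
    hd.mono (Submodule.span_le.mpr (by rintro _ ⟨q, rfl⟩; exact hdom q))
  have hcl : IsClosed (A.graph : Set (E × E)) := by
    have := LinearPMap.adjoint_isClosed hAd
    rw [hA] at this
    exact this
  have hm : ∀ q : ℕ, (q : ℂ) + 1 ≠ 0 := fun q => Nat.cast_add_one_ne_zero q
  let B : E →L[ℂ] E := T0 + (2⁻¹ : ℂ) • T1.comp Xinv
  let D : E →L[ℂ] E := T0 + (3 / 2 : ℂ) • T1.comp Xinv + (2⁻¹ : ℂ) • T2
  have hB : ∀ p q : ℕ, ⟪e p, B (e q)⟫_ℂ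
      = ((q : ℂ) + 1)⁻¹ * ((((p : ℂ) + q + 2) / 2) * c ((p : ℤ) - q)) := by
    intro p q
    simp only [B, add_apply, smul_apply,
      ContinuousLinearMap.comp_apply, hXinv, map_smul, inner_add_right, inner_smul_right, hT0, hT1]
    have := hm q
    push_cast
    field_simp
    ring
  have hD : ∀ p q : ℕ, ⟪e p, D (e q)⟫_ℂ
      = ((p : ℂ) + 1) * (((q : ℂ) + 1) ^ 2)⁻¹ * ((((p : ℂ) + q + 2) / 2) * c ((p : ℤ) - q)) := by
    intro p q
    simp only [D, add_apply, smul_apply,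
      ContinuousLinearMap.comp_apply, hXinv, map_smul, inner_add_right, inner_smul_right, hT0, hT1,
      hT2]
    have := hm q
    push_cast
    field_simp
    ring
  have hX : ∀ (p : ℕ) (y : E), ⟪e p, Xinv y⟫_ℂ = ((p : ℂ) + 1)⁻¹ * ⟪e p, y⟫_ℂ := by
    intro p y
    have : (innerSL ℂ (e p)).comp Xinv = ((p : ℂ) + 1)⁻¹ • innerSL ℂ (e p) := by
      refine ContinuousLinearMap.ext_on hd ?_
      rintro _ ⟨q, rfl⟩
      simp only [ContinuousLinearMap.comp_apply, hXinv, innerSL_apply_apply, inner_smul_right,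
        smul_apply, smul_eq_mul, aux_inner he]
      split_ifs with h
      · rw [h]
      · simp
    simpa using congrArg (fun L : E →L[ℂ] ℂ => L y) this
  refine ⟨B, D, fun ψ => ?_, fun ψ => ?_⟩
  · let F : E →L[ℂ] E × E := Xinv.prod B
    have hle : Submodule.span ℂ (Set.range e) ≤ A.graph.comap (F : E →ₗ[ℂ] E × E) := by
      refine Submodule.span_le.mpr ?_
      rintro _ ⟨q, rfl⟩
      change (Xinv (e q), B (e q)) ∈ A.graph
      have h1 : B (e q) = ((q : ℂ) + 1)⁻¹ • A ⟨e q, hdom q⟩ :=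
        aux_ext he fun p => by rw [hB, inner_smul_right, hAe]
      rw [h1, hXinv]
      exact A.graph.smul_mem _ (A.mem_graph ⟨e q, hdom q⟩)
    have hclosed : IsClosed {ψ : E | F ψ ∈ (A.graph : Set (E × E))} := hcl.preimage F.continuous
    have := hclosed.closure_subset_iff.mpr (show (Submodule.span ℂ (Set.range e) : Set E) ⊆ _ from hle)
    exact this (hd ψ)
  · have : Xinv.comp D = B.comp Xinv := by
      refine ContinuousLinearMap.ext_on hd ?_
      rintro _ ⟨q, rfl⟩
      refine aux_ext he fun p => ?_
      simp only [ContinuousLinearMap.comp_apply, hX, hXinv, map_smul, inner_smul_right, hD, hB]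
      have := hm q
      have := hm p
      field_simp
    exact congrArg (fun L : E →L[ℂ] E => L ψ) this

/-- For real-valued `g ∈ C²(𝕋)`, the operators `A_g X⁻¹` and
`A_g² X⁻²` are bounded (everywhere defined with a norm bound). -/
theorem stmt_4 (e : ℕ → E) (he : IsONBasis e)
    (g : ℝ → ℝ) (hg : ContDiff ℝ 2 g) (hgp : Function.Periodic g (2 * Real.pi))
    (A : E →ₗ.[ℂ] E) (hA : IsAg e (fun x => Complex.ofReal (g x)) A)
    (Xinv : E →L[ℂ] E) (hXinv : ∀ n : ℕ, Xinv (e n) = (((n : ℂ) + 1)⁻¹) • e n) :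
    (∃ C : ℝ, ∀ ψ : E, ∃ h : Xinv ψ ∈ A.domain, ‖A ⟨Xinv ψ, h⟩‖ ≤ C * ‖ψ‖) ∧
    (∃ C : ℝ, ∀ ψ : E, ∃ h1 : Xinv (Xinv ψ) ∈ A.domain,
      ∃ h2 : A ⟨Xinv (Xinv ψ), h1⟩ ∈ A.domain,
        ‖A ⟨A ⟨Xinv (Xinv ψ), h1⟩, h2⟩‖ ≤ C * ‖ψ‖) := by
  obtain ⟨hadj, hA2⟩ := hA
  choose hdom hAe using hA2
  obtain ⟨B, D, hG, hXD⟩ := aux_main he _ (aux_g g hg hgp) A hadj hdom (fun p q => hAe q p)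
    Xinv hXinv
  have hG' : ∀ ψ : E, ∃ h : Xinv ψ ∈ A.domain, A ⟨Xinv ψ, h⟩ = B ψ := by
    intro ψ
    obtain ⟨y, hy1, hy2⟩ := (LinearPMap.mem_graph_iff A).mp (hG ψ)
    simp only at hy1 hy2
    have h : Xinv ψ ∈ A.domain := hy1 ▸ y.2
    refine ⟨h, ?_⟩
    rw [← hy2]
    congr 1
    exact Subtype.ext hy1.symm
  refine ⟨⟨‖B‖, fun ψ => ?_⟩, ⟨‖B.comp D‖, fun ψ => ?_⟩⟩
  · obtain ⟨h, hh⟩ := hG' ψ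
    exact ⟨h, hh ▸ B.le_opNorm ψ⟩
  · obtain ⟨h1, hh1⟩ := hG' (Xinv ψ)
    obtain ⟨h2, hh2⟩ := hG' (D ψ)
    have heq : A ⟨Xinv (Xinv ψ), h1⟩ = Xinv (D ψ) := by rw [hh1, hXD]
    have h2' : A ⟨Xinv (Xinv ψ), h1⟩ ∈ A.domain := heq ▸ h2
    refine ⟨h1, h2', ?_⟩
    have : A ⟨A ⟨Xinv (Xinv ψ), h1⟩, h2'⟩ = B (D ψ) := by
      rw [← hh2]
      congr 1
      exact Subtype.ext heq
    rw [this]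
    exact (B.comp D).le_opNorm ψ
end
end

section
/- Let f, g ∈ C²(𝕋) be real-valued. Then the sesquilinear forms F_+(φ,ψ) = ⟨φ, X H_f* H_g ψ⟩ and F_−(φ,ψ) = ⟨φ, H_g* H_f X ψ⟩, defined on the span of the canonical basis of ℓ²(ℕ), are continuous for the topology induced by ℓ²(ℕ) × ℓ²(ℕ), and hence extend to bounded operators. -/
open scoped InnerProductSpace
open Complex

noncomputable section

variable {E : Type*} [NormedAddCommGroup E] [InnerProductSpace ℂ E] [CompleteSpace E]

theorem fcoef_norm_le (h : ℝ → ℂ) (hc : Continuous h) :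
    ∃ C : ℝ, 0 ≤ C ∧ ∀ n : ℤ, ‖fcoef h n‖ ≤ C := by
  obtain ⟨M, hM⟩ := (isCompact_Icc (a := (0:ℝ)) (b := 2 * Real.pi)).exists_bound_of_continuousOn
    hc.continuousOn
  have hpi := Real.pi_pos
  have hM0 : 0 ≤ M := (norm_nonneg _).trans (hM 0 ⟨le_rfl, by positivity⟩)
  refine ⟨|1 / (2 * Real.pi)| * (M * |2 * Real.pi - 0|), by positivity, fun n => ?_⟩
  unfold fcoef
  rw [norm_smul, Real.norm_eq_abs]
  gcongr
  apply intervalIntegral.norm_integral_le_of_norm_le_const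
  intro x hx
  rw [Set.uIoc_of_le (by positivity)] at hx
  have : ‖Complex.exp (-Complex.I * n * x)‖ = 1 := by
    have := Complex.norm_exp_ofReal_mul_I (-(n * x))
    rw [← this]; congr 2; push_cast; ring
  rw [norm_mul, this, one_mul]
  exact hM x ⟨hx.1.le, hx.2⟩

theorem fcoef_deriv_s6 (h h' : ℝ → ℂ) (hd : ∀ x, HasDerivAt h (h' x) x) (hc : Continuous h')
    (hp : Function.Periodic h (2 * Real.pi)) (n : ℤ) :
    fcoef h' n = Complex.I * n * fcoef h n := by
  have hu : ∀ x : ℝ, HasDerivAt (fun x : ℝ => Complex.exp (-Complex.I * n * x))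
      (Complex.exp (-Complex.I * n * x) * (-Complex.I * n)) x := by
    intro x
    have h1 : HasDerivAt (fun x : ℝ => -Complex.I * n * (x : ℂ)) (-Complex.I * n) x := by
      simpa using (Complex.ofRealCLM.hasDerivAt (x := x)).const_mul (-Complex.I * n)
    exact h1.cexp
  have key := intervalIntegral.integral_mul_deriv_eq_deriv_mul (a := 0) (b := 2 * Real.pi)
    (u := fun x : ℝ => Complex.exp (-Complex.I * n * x)) (v := h)
    (fun x _ => hu x) (fun x _ => hd x)
    (by apply Continuous.intervalIntegrable; fun_prop) (hc.intervalIntegrable _ _)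
  have he : Complex.exp (-Complex.I * n * ((2 * Real.pi : ℝ) : ℂ)) = 1 := by
    rw [Complex.exp_eq_one_iff]
    exact ⟨-n, by push_cast; ring⟩
  have hpp : h (2 * Real.pi) = h 0 := by simpa using hp 0
  unfold fcoef
  rw [key, he, hpp]
  have : (∫ x in (0:ℝ)..(2 * Real.pi), Complex.exp (-Complex.I * n * x) * (-Complex.I * n) * h x)
      = (-Complex.I * n) * ∫ x in (0:ℝ)..(2 * Real.pi), Complex.exp (-Complex.I * n * x) * h x := by
    rw [← intervalIntegral.integral_const_mul]
    congr 1; ext x; ring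
  rw [this]
  simp only [Complex.real_smul]
  simp
  ring

theorem fcoef_decay (f : ℝ → ℝ) (hf : ContDiff ℝ 2 f) (hfp : Function.Periodic f (2 * Real.pi)) :
    ∃ C : ℝ, 0 ≤ C ∧ ∀ n : ℕ,
      ‖fcoef (fun x => Complex.ofReal (f x)) ((n : ℤ) + 1)‖ ≤ C * ((n : ℝ) + 1) ^ (-2 : ℝ) := by
  have hf1 : ContDiff ℝ 1 (deriv f) := by
    have : ContDiff ℝ (1 + 1) f := by simpa [one_add_one_eq_two] using hf
    exact ((contDiff_succ_iff_deriv).1 this).2.2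
  have hd1 : ∀ x, HasDerivAt f (deriv f x) x :=
    fun x => (hf.differentiable (by norm_num) x).hasDerivAt
  have hd2 : ∀ x, HasDerivAt (deriv f) (deriv (deriv f) x) x :=
    fun x => (hf1.differentiable (by norm_num) x).hasDerivAt
  have hc2 : Continuous (deriv (deriv f)) := hf1.continuous_deriv le_rfl
  have hp1 : Function.Periodic (deriv f) (2 * Real.pi) := by
    intro x
    have : (fun y => f (y + 2 * Real.pi)) = f := funext hfp
    rw [← deriv_comp_add_const, this]
  obtain ⟨C, hC, hb⟩ := fcoef_norm_le (fun x => ((deriv (deriv f) x : ℝ) : ℂ))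
    (Complex.continuous_ofReal.comp hc2)
  refine ⟨C, hC, fun n => ?_⟩
  have e1 := fcoef_deriv_s6 (fun x => ((f x : ℝ) : ℂ)) (fun x => ((deriv f x : ℝ) : ℂ))
    (fun x => (hd1 x).ofReal_comp) (Complex.continuous_ofReal.comp hf1.continuous)
    (fun x => by simp [hfp x]) ((n : ℤ) + 1)
  have e2 := fcoef_deriv_s6 (fun x => ((deriv f x : ℝ) : ℂ)) (fun x => ((deriv (deriv f) x : ℝ) : ℂ))
    (fun x => (hd2 x).ofReal_comp) (Complex.continuous_ofReal.comp hc2)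
    (fun x => by simp [hp1 x]) ((n : ℤ) + 1)
  have hb' := hb ((n : ℤ) + 1)
  rw [e2, e1] at hb'
  have hn : (0 : ℝ) < (n : ℝ) + 1 := by positivity
  have hnn : ‖(((n : ℤ) + 1 : ℤ) : ℂ)‖ = (n : ℝ) + 1 := by
    have : (((n : ℤ) + 1 : ℤ) : ℂ) = (((n : ℝ) + 1 : ℝ) : ℂ) := by push_cast; ring
    rw [this, Complex.norm_real, Real.norm_of_nonneg hn.le]
  simp only [norm_mul, Complex.norm_I, one_mul, hnn] at hb'
  rw [Real.rpow_neg hn.le, ← div_eq_mul_inv, le_div_iff₀ (by positivity), Real.rpow_two]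
  linarith

theorem summable_shift (s : ℝ) (hs : s < -1) : Summable fun k : ℕ => ((k : ℝ) + 1) ^ s := by
  have := (summable_nat_add_iff 1).2 (Real.summable_nat_rpow.2 hs)
  simpa using this

theorem term_bound (p q k : ℕ) :
    ((p : ℝ) + 1) * (((p + k : ℕ) : ℝ) + 1) ^ (-2 : ℝ) * (((k + q : ℕ) : ℝ) + 1) ^ (-2 : ℝ) ≤
      ((p : ℝ) + 1) ^ (-3/4 : ℝ) * ((q : ℝ) + 1) ^ (-9/8 : ℝ) * ((k : ℝ) + 1) ^ (-9/8 : ℝ) := by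
  have hp : (0:ℝ) < (p : ℝ) + 1 := by positivity
  have hq : (0:ℝ) < (q : ℝ) + 1 := by positivity
  have hk : (0:ℝ) < (k : ℝ) + 1 := by positivity
  push_cast
  have hpk : (0:ℝ) < (p : ℝ) + k + 1 := by positivity
  have hkq : (0:ℝ) < (k : ℝ) + q + 1 := by positivity
  have hk0 : (0:ℝ) ≤ k := by positivity
  have hq0 : (0:ℝ) ≤ q := by positivity
  have hp0 : (0:ℝ) ≤ p := by positivity
  have a1 : ((p : ℝ) + k + 1) ^ (-2 : ℝ) ≤ ((p : ℝ) + 1) ^ (-7/4 : ℝ) * ((k : ℝ) + 1) ^ (-1/4 : ℝ) := by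
    rw [show (-2 : ℝ) = -7/4 + -1/4 by norm_num, Real.rpow_add hpk]
    exact mul_le_mul (Real.rpow_le_rpow_of_nonpos hp (by linarith) (by norm_num))
      (Real.rpow_le_rpow_of_nonpos hk (by linarith) (by norm_num)) (by positivity) (by positivity)
  have a2 : ((k : ℝ) + q + 1) ^ (-2 : ℝ) ≤ ((q : ℝ) + 1) ^ (-9/8 : ℝ) * ((k : ℝ) + 1) ^ (-7/8 : ℝ) := by
    rw [show (-2 : ℝ) = -9/8 + -7/8 by norm_num, Real.rpow_add hkq]
    exact mul_le_mul (Real.rpow_le_rpow_of_nonpos hq (by linarith) (by norm_num))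
      (Real.rpow_le_rpow_of_nonpos hk (by linarith) (by norm_num)) (by positivity) (by positivity)
  have b1 : ((p : ℝ) + 1) * ((p : ℝ) + 1) ^ (-7/4 : ℝ) = ((p : ℝ) + 1) ^ (-3/4 : ℝ) := by
    rw [show (-3/4 : ℝ) = 1 + -7/4 by norm_num, Real.rpow_add hp, Real.rpow_one]
  have b2 : ((k : ℝ) + 1) ^ (-1/4 : ℝ) * ((k : ℝ) + 1) ^ (-7/8 : ℝ) = ((k : ℝ) + 1) ^ (-9/8 : ℝ) := by
    rw [← Real.rpow_add hk]; norm_num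
  calc _ ≤ ((p : ℝ) + 1) * (((p : ℝ) + 1) ^ (-7/4 : ℝ) * ((k : ℝ) + 1) ^ (-1/4 : ℝ)) *
        (((q : ℝ) + 1) ^ (-9/8 : ℝ) * ((k : ℝ) + 1) ^ (-7/8 : ℝ)) := by gcongr
    _ = (((p : ℝ) + 1) * ((p : ℝ) + 1) ^ (-7/4 : ℝ)) * ((q : ℝ) + 1) ^ (-9/8 : ℝ) *
        (((k : ℝ) + 1) ^ (-1/4 : ℝ) * ((k : ℝ) + 1) ^ (-7/8 : ℝ)) := by ring
    _ = _ := by rw [b1, b2]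

theorem exists_vec (e : ℕ → E) (he : IsONBasis e) (c : ℕ → ℂ) (K : ℝ) (hK : 0 ≤ K)
    (hc : ∀ p : ℕ, ‖c p‖ ≤ K * ((p : ℝ) + 1) ^ (-3/4 : ℝ)) :
    ∃ v : E, (∀ p, ⟪e p, v⟫_ℂ = c p) ∧
      ‖v‖ ≤ K * Real.sqrt (∑' k : ℕ, ((k : ℝ) + 1) ^ (-3/2 : ℝ)) := by
  obtain ⟨b, hb⟩ : ∃ b : HilbertBasis ℕ ℂ E, ∀ p, b p = e p :=
    ⟨HilbertBasis.mk he.1 he.2.ge, fun p => by rw [HilbertBasis.coe_mk]⟩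
  have hsum := summable_shift (-3/2) (by norm_num)
  have hsq : ∀ p : ℕ, ‖c p‖ ^ (2 : ℝ) ≤ K ^ 2 * ((p : ℝ) + 1) ^ (-3/2 : ℝ) := by
    intro p
    have hp : (0:ℝ) < (p : ℝ) + 1 := by positivity
    rw [Real.rpow_two]
    calc _ ≤ (K * ((p : ℝ) + 1) ^ (-3/4 : ℝ)) ^ 2 :=
          pow_le_pow_left₀ (norm_nonneg _) (hc p) 2
      _ = K ^ 2 * (((p : ℝ) + 1) ^ (-3/4 : ℝ) * ((p : ℝ) + 1) ^ (-3/4 : ℝ)) := by ring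
      _ = _ := by rw [← Real.rpow_add hp]; norm_num
  have hs2 : Summable fun p : ℕ => ‖c p‖ ^ (2 : ℝ) :=
    Summable.of_nonneg_of_le (fun _ => Real.rpow_nonneg (norm_nonneg _) _) hsq (hsum.mul_left _)
  have hmem : Memℓp c 2 := by
    refine memℓp_gen ?_
    simpa only [ENNReal.toReal_ofNat] using hs2
  have hS0 : 0 ≤ ∑' k : ℕ, ((k : ℝ) + 1) ^ (-3/2 : ℝ) := tsum_nonneg fun _ => by positivity
  refine ⟨b.repr.symm ⟨c, hmem⟩, fun p => ?_, ?_⟩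
  · rw [← hb, ← b.repr_apply_apply, LinearIsometryEquiv.apply_symm_apply]
  · rw [LinearIsometryEquiv.norm_map]
    refine lp.norm_le_of_tsum_le (by norm_num) (by positivity) ?_
    simp only [ENNReal.toReal_ofNat]
    calc _ ≤ ∑' p : ℕ, K ^ 2 * ((p : ℝ) + 1) ^ (-3/2 : ℝ) :=
          Summable.tsum_le_tsum hsq hs2 (hsum.mul_left _)
      _ = K ^ 2 * ∑' p : ℕ, ((p : ℝ) + 1) ^ (-3/2 : ℝ) := by rw [tsum_mul_left]
      _ = _ := by rw [Real.rpow_two, mul_pow, Real.sq_sqrt hS0]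

/-- A matrix with entries dominated by `D (p+1)^{-3/4} (q+1)^{-9/8}` is that of a bounded operator. -/
theorem exists_op (e : ℕ → E) (he : IsONBasis e) (a : ℕ → ℕ → ℂ) (D : ℝ) (hD : 0 ≤ D)
    (ha : ∀ p q : ℕ, ‖a p q‖ ≤ D * (((p : ℝ) + 1) ^ (-3/4 : ℝ) * ((q : ℝ) + 1) ^ (-9/8 : ℝ))) :
    ∃ B : E →L[ℂ] E, ∀ p q : ℕ, ⟪e p, B (e q)⟫_ℂ = a p q := by
  have hvec := fun q : ℕ => exists_vec e he (fun p => a p q) (D * ((q : ℝ) + 1) ^ (-9/8 : ℝ))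
    (by positivity) (fun p => (ha p q).trans (le_of_eq (by ring)))
  choose v hv hvn using hvec
  obtain ⟨T, hTdef⟩ : ∃ T : ℕ → (E →L[ℂ] E), ∀ q, T q = (innerSL ℂ (e q)).smulRight (v q) :=
    ⟨_, fun _ => rfl⟩
  have hT : Summable T := by
    refine Summable.of_norm_bounded ((summable_shift (-9/8) (by norm_num)).mul_left
      (D * Real.sqrt (∑' k : ℕ, ((k : ℝ) + 1) ^ (-3/2 : ℝ)))) fun q => ?_
    rw [hTdef, ContinuousLinearMap.norm_smulRight_apply, innerSL_apply_norm, he.1.1 q, one_mul]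
    exact (hvn q).trans (le_of_eq (by ring))
  refine ⟨∑' q, T q, fun p q => ?_⟩
  have h1 : HasSum (fun r => T r (e q)) ((∑' r, T r) (e q)) :=
    (ContinuousLinearMap.apply ℂ E (e q)).hasSum hT.hasSum
  have h2 : HasSum (fun r => T r (e q)) (v q) := by
    have : (fun r => T r (e q)) = fun r => if r = q then v q else 0 := by
      funext r
      rw [hTdef, ContinuousLinearMap.smulRight_apply, innerSL_apply_apply,
        orthonormal_iff_ite.1 he.1 r q]
      split_ifs with h
      · rw [h, one_smul]
      · rw [zero_smul]
    rw [this]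
    exact hasSum_ite_eq q (v q)
  rw [h1.unique h2, hv]

/-- For real-valued `f, g ∈ C²(𝕋)` the forms
`F₊(φ,ψ) = ⟨φ, X H_f* H_g ψ⟩` and `F₋(φ,ψ) = ⟨φ, H_g* H_f X ψ⟩` on the span of
the canonical basis are bounded: they are represented by bounded operators. -/
theorem stmt_6 (e : ℕ → E) (he : IsONBasis e)
    (f g : ℝ → ℝ) (hf : ContDiff ℝ 2 f) (hg : ContDiff ℝ 2 g)
    (hfp : Function.Periodic f (2 * Real.pi)) (hgp : Function.Periodic g (2 * Real.pi))
    (Hf Hg : E →L[ℂ] E)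
    (hHf : IsHankel e (fun x => Complex.ofReal (f x)) Hf)
    (hHg : IsHankel e (fun x => Complex.ofReal (g x)) Hg) :
    (∃ Bp : E →L[ℂ] E, ∀ p q : ℕ,
        ⟪e p, Bp (e q)⟫_ℂ =
          ((p : ℂ) + 1) * ⟪e p, (ContinuousLinearMap.adjoint Hf) (Hg (e q))⟫_ℂ) ∧
    (∃ Bm : E →L[ℂ] E, ∀ p q : ℕ,
        ⟪e p, Bm (e q)⟫_ℂ =
          ((q : ℂ) + 1) * ⟪e p, (ContinuousLinearMap.adjoint Hg) (Hf (e q))⟫_ℂ) := by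
  classical
  obtain ⟨Cf, hCf, hfb⟩ := fcoef_decay f hf hfp
  obtain ⟨Cg, hCg, hgb⟩ := fcoef_decay g hg hgp
  let b : HilbertBasis ℕ ℂ E := HilbertBasis.mk he.1 he.2.ge
  have hb : ∀ p, b p = e p := fun p => by simp [b]
  have hsum := summable_shift (-9/8) (by norm_num)
  have hent : ∀ p q : ℕ, ‖((p : ℂ) + 1) * ⟪e p, (ContinuousLinearMap.adjoint Hf) (Hg (e q))⟫_ℂ‖ ≤
      (Cf * Cg * ∑' k : ℕ, ((k : ℝ) + 1) ^ (-9/8 : ℝ)) *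
        (((p : ℝ) + 1) ^ (-3/4 : ℝ) * ((q : ℝ) + 1) ^ (-9/8 : ℝ)) := by
    intro p q
    rw [ContinuousLinearMap.adjoint_inner_right]
    have h1 := (b.hasSum_inner_mul_inner (Hf (e p)) (Hg (e q))).mul_left ((p : ℂ) + 1)
    rw [← h1.tsum_eq]
    have h2 := hsum.hasSum.mul_left
      (Cf * Cg * (((p : ℝ) + 1) ^ (-3/4 : ℝ) * ((q : ℝ) + 1) ^ (-9/8 : ℝ)))
    refine (tsum_of_norm_bounded h2 fun k => ?_).trans (le_of_eq (by ring))
    have n1 : ‖⟪Hf (e p), b k⟫_ℂ‖ ≤ Cf * (((p + k : ℕ) : ℝ) + 1) ^ (-2 : ℝ) := by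
      rw [norm_inner_symm, hb, hHf,
        show ((k : ℤ) + p + 1) = ((p + k : ℕ) : ℤ) + 1 by push_cast; ring]
      exact hfb (p + k)
    have n2 : ‖⟪b k, Hg (e q)⟫_ℂ‖ ≤ Cg * (((k + q : ℕ) : ℝ) + 1) ^ (-2 : ℝ) := by
      rw [hb, hHg, show ((k : ℤ) + q + 1) = ((k + q : ℕ) : ℤ) + 1 by push_cast; ring]
      exact hgb (k + q)
    have n3 : ‖(p : ℂ) + 1‖ = (p : ℝ) + 1 := by
      have : (p : ℂ) + 1 = (((p : ℝ) + 1 : ℝ) : ℂ) := by push_cast; ring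
      rw [this, Complex.norm_real, Real.norm_of_nonneg (by positivity)]
    rw [norm_mul, norm_mul, n3]
    calc _ ≤ ((p : ℝ) + 1) * ((Cf * (((p + k : ℕ) : ℝ) + 1) ^ (-2 : ℝ)) *
          (Cg * (((k + q : ℕ) : ℝ) + 1) ^ (-2 : ℝ))) := by gcongr
      _ = Cf * Cg * (((p : ℝ) + 1) * (((p + k : ℕ) : ℝ) + 1) ^ (-2 : ℝ) *
          (((k + q : ℕ) : ℝ) + 1) ^ (-2 : ℝ)) := by ring
      _ ≤ Cf * Cg * (((p : ℝ) + 1) ^ (-3/4 : ℝ) * ((q : ℝ) + 1) ^ (-9/8 : ℝ) *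
          ((k : ℝ) + 1) ^ (-9/8 : ℝ)) := 
          mul_le_mul_of_nonneg_left (term_bound p q k) (mul_nonneg hCf hCg)
      _ = _ := by ring
  obtain ⟨B, hB⟩ := exists_op e he
    (fun p q => ((p : ℂ) + 1) * ⟪e p, (ContinuousLinearMap.adjoint Hf) (Hg (e q))⟫_ℂ) _
    (mul_nonneg (mul_nonneg hCf hCg) (tsum_nonneg fun _ => by positivity)) hent
  refine ⟨⟨B, hB⟩, ContinuousLinearMap.adjoint B, fun p q => ?_⟩
  rw [ContinuousLinearMap.adjoint_inner_right, ← inner_conj_symm, hB,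
    ContinuousLinearMap.adjoint_inner_right, ContinuousLinearMap.adjoint_inner_right, map_mul,
    inner_conj_symm]
  simp
end
end

section
/- Let H be a bounded self-adjoint operator of class C¹ with respect to a self-adjoint operator A, and suppose H is conjugate to A on a Borel set Λ, i.e., E_Λ(H) i[A,H] E_Λ(H) ≥ c E_Λ(H) + K for some c > 0 and compact K. Then H has only finitely many eigenvalues in Λ, each of finite multiplicity. -/
open scoped InnerProductSpace
open Complex

noncomputable section

variable {E : Type*} [NormedAddCommGroup E] [InnerProductSpace ℂ E] [CompleteSpace E]

section VirialHelpers

open Filter Topology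

theorem sa_sym (A : E →ₗ.[ℂ] E) (hA : A.adjoint = A) (x y : A.domain) :
    ⟪A x, (y : E)⟫_ℂ = ⟪(x : E), A y⟫_ℂ := by
  have hd : Dense (A.domain : Set E) := IsSelfAdjoint.dense_domain (A := A) hA
  have h := LinearPMap.adjoint_isFormalAdjoint hd
  rw [hA] at h
  exact h x y

theorem sa_bound (A : E →ₗ.[ℂ] E) (hA : A.adjoint = A) (t : ℝ) (x : A.domain) :
    ‖(x : E)‖ ≤ ‖(x : E) + (Complex.I * t) • A x‖ := by
  have h1 : (⟪(x : E), A x⟫_ℂ).im = 0 := by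
    have := sa_sym A hA x x
    rw [← inner_conj_symm] at this
    have h2 := congrArg Complex.im this
    simp only [Complex.conj_im] at h2
    linarith
  have h3 : (⟪(x : E), (x : E) + (Complex.I * t) • A x⟫_ℂ).re = ‖(x : E)‖ ^ 2 := by
    rw [inner_add_right, inner_smul_right, inner_self_eq_norm_sq_to_K]
    simp [h1, ← Complex.ofReal_pow]
  have h4 : (⟪(x : E), (x : E) + (Complex.I * t) • A x⟫_ℂ).re
      ≤ ‖(x : E)‖ * ‖(x : E) + (Complex.I * t) • A x‖ :=
    (Complex.re_le_norm _).trans (norm_inner_le_norm _ _)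
  rw [h3, sq] at h4
  by_cases h0 : ‖(x : E)‖ = 0
  · rw [h0]; positivity
  · exact le_of_mul_le_mul_left h4 (lt_of_le_of_ne (norm_nonneg _) (Ne.symm h0))

theorem sa_surj (A : E →ₗ.[ℂ] E) (hA : A.adjoint = A) (t : ℝ) (ht : t ≠ 0) (u : E) :
    ∃ x : A.domain, (x : E) + (Complex.I * t) • A x = u := by
  have hd : Dense (A.domain : Set E) := IsSelfAdjoint.dense_domain (A := A) hA
  have ha : (Complex.I * t : ℂ) ≠ 0 := mul_ne_zero Complex.I_ne_zero (by exact_mod_cast ht)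
  have hcl : IsClosed (A.graph : Set (E × E)) := by
    have := LinearPMap.adjoint_isClosed hd
    rw [hA] at this
    exact this
  haveI : CompleteSpace A.graph := hcl.completeSpace_coe
  let g : A.graph →L[ℂ] E :=
    (ContinuousLinearMap.fst ℂ E E + (Complex.I * t : ℂ) • ContinuousLinearMap.snd ℂ E E).comp
      A.graph.subtypeL
  have hg : ∀ p : A.graph, g p = p.1.1 + (Complex.I * t : ℂ) • p.1.2 := fun p => rfl
  have hb1 : ∀ p : A.graph, ‖p.1.1‖ ≤ ‖g p‖ := by
    rintro ⟨⟨a, b⟩, hp⟩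
    obtain ⟨x, hx1, hx2⟩ := (LinearPMap.mem_graph_iff A).1 hp
    rw [hg]
    simp only at hx1 hx2 ⊢
    rw [← hx1, ← hx2]
    exact sa_bound A hA t x
  have hb2 : ∀ p : A.graph, ‖p.1.2‖ ≤ 2 / |t| * ‖g p‖ := by
    intro p
    have h1 : (Complex.I * t : ℂ) • p.1.2 = g p - p.1.1 := by rw [hg]; abel
    have h2 : |t| * ‖p.1.2‖ = ‖g p - p.1.1‖ := by
      rw [← h1, norm_smul]; simp
    have h3 : |t| * ‖p.1.2‖ ≤ 2 * ‖g p‖ := by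
      rw [h2]; linarith [norm_sub_le (g p) p.1.1, hb1 p]
    have h4 : 0 < |t| := abs_pos.2 ht
    rw [div_mul_eq_mul_div, le_div_iff₀ h4]; linarith
  have hb : ∀ p : A.graph, ‖p‖ ≤ (Real.toNNReal (1 + 2 / |t|) : ℝ) * ‖g p‖ := by
    intro p
    have h0 : 0 ≤ 2 / |t| := by positivity
    rw [Real.coe_toNNReal _ (by positivity)]
    have : ‖p‖ = max ‖p.1.1‖ ‖p.1.2‖ := rfl
    rw [this]
    have h5 := mul_nonneg h0 (norm_nonneg (g p))
    exact max_le (by linarith [hb1 p]) (by linarith [hb2 p, norm_nonneg (g p)])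
  have hanti := AddMonoidHomClass.antilipschitz_of_bound g hb
  have hrc : IsClosed (Set.range g) := hanti.isClosed_range g.uniformContinuous
  have hrc' : IsClosed ((LinearMap.range (g : A.graph →ₗ[ℂ] E) : Submodule ℂ E) : Set E) := by
    rw [LinearMap.coe_range]
    exact hrc
  have htop : LinearMap.range (g : A.graph →ₗ[ℂ] E) = ⊤ := by
    haveI : CompleteSpace (LinearMap.range (g : A.graph →ₗ[ℂ] E)) := hrc'.completeSpace_coe
    rw [← Submodule.orthogonal_eq_bot_iff, Submodule.eq_bot_iff]
    intro z hz
    rw [Submodule.mem_orthogonal'] at hz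
    have hz1 : ∀ x : A.domain, ⟪z, (x : E)⟫_ℂ + (Complex.I * t) * ⟪z, A x⟫_ℂ = 0 := by
      intro x
      have := hz (g ⟨((x : E), A x), LinearPMap.mem_graph A x⟩) ⟨_, rfl⟩
      rw [hg] at this
      simpa [inner_add_right, inner_smul_right] using this
    have hzd : z ∈ A.adjoint.domain := by
      refine LinearPMap.mem_adjoint_domain_of_exists z ⟨(Complex.I * t)⁻¹ • z, fun x => ?_⟩
      rw [inner_smul_left]
      have h := hz1 x
      have hc : (starRingEnd ℂ) (Complex.I * t)⁻¹ = - (Complex.I * t)⁻¹ := by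
        simp [mul_comm, ← neg_inv]
      rw [hc, eq_neg_of_add_eq_zero_left h]
      rw [neg_mul_neg, inv_mul_cancel_left₀ ha]
    rw [hA] at hzd
    have h0 : z + (Complex.I * (-t : ℝ)) • A ⟨z, hzd⟩ = 0 := by
      refine hd.eq_zero_of_inner_left ℂ fun x hx => ?_
      have h := hz1 ⟨x, hx⟩
      have h' := sa_sym A hA ⟨z, hzd⟩ ⟨x, hx⟩
      simp only at h' h
      rw [← h'] at h
      rw [inner_add_left, inner_smul_left, ← h]
      simp
    have := sa_bound A hA (-t) ⟨z, hzd⟩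
    simp only at this
    rw [h0, norm_zero] at this
    simpa using this
  have hu : u ∈ LinearMap.range (g : A.graph →ₗ[ℂ] E) := by rw [htop]; trivial
  obtain ⟨⟨⟨a, b⟩, hp⟩, hpu⟩ := hu
  obtain ⟨x, hx1, hx2⟩ := (LinearPMap.mem_graph_iff A).1 hp
  refine ⟨x, ?_⟩
  simp only at hx1 hx2
  rw [hx1, hx2]
  exact hpu

/-- the resolvents converge strongly to the identity -/
theorem sa_tendsto (A : E →ₗ.[ℂ] E) (hA : A.adjoint = A) (u : E) (t : ℕ → ℝ)
    (ht : Tendsto t atTop (𝓝 0)) (x : ℕ → A.domain)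
    (hx : ∀ n, (x n : E) + (Complex.I * t n) • A (x n) = u) :
    Tendsto (fun n => (x n : E)) atTop (𝓝 u) := by
  have hd : Dense (A.domain : Set E) := IsSelfAdjoint.dense_domain (A := A) hA
  rw [Metric.tendsto_atTop]
  intro ε hε
  obtain ⟨w, hw, hwu⟩ := Metric.dense_iff.1 hd u (ε / 4) (by positivity)
  rw [Metric.mem_ball, dist_eq_norm] at hw
  have hlim : Tendsto (fun n => |t n| * ‖A ⟨w, hwu⟩‖) atTop (𝓝 0) := by
    have := (ht.abs).mul_const ‖A ⟨w, hwu⟩‖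
    simpa using this
  obtain ⟨N, hN⟩ := (Metric.tendsto_atTop.1 hlim) (ε / 4) (by positivity)
  refine ⟨N, fun n hn => ?_⟩
  have h1 := sa_bound A hA (t n) (x n - ⟨w, hwu⟩)
  have h2 : ((x n - ⟨w, hwu⟩ : A.domain) : E) + (Complex.I * t n) • A (x n - ⟨w, hwu⟩)
      = (u - w) - (Complex.I * t n) • A ⟨w, hwu⟩ := by
    rw [LinearPMap.map_sub, smul_sub, ← hx n, AddSubgroupClass.coe_sub]
    abel
  rw [h2] at h1
  have h3 : ‖(Complex.I * t n : ℂ) • A ⟨w, hwu⟩‖ = |t n| * ‖A ⟨w, hwu⟩‖ := by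
    rw [norm_smul]; simp
  have h4 := norm_sub_le (u - w) ((Complex.I * t n : ℂ) • A ⟨w, hwu⟩)
  rw [h3] at h4
  have h5 := hN n hn
  rw [Real.dist_eq, sub_zero] at h5
  have h6 := (le_abs_self _).trans_lt h5
  rw [AddSubgroupClass.coe_sub] at h1
  rw [dist_eq_norm]
  have h7 : (x n : E) - u = ((x n : E) - w) + (w - u) := by abel
  rw [h7]
  have h8 := norm_add_le ((x n : E) - w) (w - u)
  rw [norm_sub_rev u w] at h4
  linarith

theorem virial (Hop : E →L[ℂ] E) (hsa : IsSelfAdjoint Hop)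
    (A : E →ₗ.[ℂ] E) (hA : A.adjoint = A)
    (D : E →L[ℂ] E) (hD : CommutatorOf A Hop D) (μ : ℝ) (ψ : E)
    (hψ : Hop ψ = (μ : ℂ) • ψ) : ⟪ψ, D ψ⟫_ℂ = 0 := by
  have hH : ∀ a b : E, ⟪Hop a, b⟫_ℂ = ⟪a, Hop b⟫_ℂ := fun a b => hsa.isSymmetric a b
  let t : ℕ → ℝ := fun n => 1 / ((n : ℝ) + 1)
  have ht : Tendsto t atTop (𝓝 0) := tendsto_one_div_add_atTop_nhds_zero_nat
  have ht0 : ∀ n, t n ≠ 0 := fun n => by positivity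
  choose x hx using fun n => sa_surj A hA (t n) (ht0 n) ψ
  choose y hy using fun n => sa_surj A hA (-t n) (neg_ne_zero.2 (ht0 n)) ψ
  have hxl := sa_tendsto A hA ψ t ht x hx
  have hyl := sa_tendsto A hA ψ (fun n => -t n) (by simpa using ht.neg) y hy
  have hz : ∀ n, ⟪(y n : E), D (x n)⟫_ℂ = 0 := by
    intro n
    have ha : (Complex.I * t n : ℂ) ≠ 0 :=
      mul_ne_zero Complex.I_ne_zero (by exact_mod_cast ht0 n)
    have e1 : (Complex.I * t n : ℂ) * ⟪A (y n), Hop (x n)⟫_ℂ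
        = ⟪ψ, Hop (x n)⟫_ℂ - ⟪(y n : E), Hop (x n)⟫_ℂ := by
      rw [← inner_sub_left, ← hy n, add_sub_cancel_left, inner_smul_left]
      simp
    have e2 : (Complex.I * t n : ℂ) * ⟪(y n : E), Hop (A (x n))⟫_ℂ
        = ⟪(y n : E), Hop ψ⟫_ℂ - ⟪(y n : E), Hop (x n)⟫_ℂ := by
      rw [← inner_sub_right, ← map_sub, ← hx n, add_sub_cancel_left, map_smul, inner_smul_right]
    have e3 : ⟪ψ, (x n : E)⟫_ℂ = ⟪(y n : E), ψ⟫_ℂ := by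
      have l : ⟪ψ, (x n : E)⟫_ℂ
          = ⟪(y n : E), (x n : E)⟫_ℂ + (Complex.I * t n : ℂ) * ⟪A (y n), (x n : E)⟫_ℂ := by
        conv_lhs => rw [← hy n]
        rw [inner_add_left, inner_smul_left]
        simp
      have r : ⟪(y n : E), ψ⟫_ℂ
          = ⟪(y n : E), (x n : E)⟫_ℂ + (Complex.I * t n : ℂ) * ⟪(y n : E), A (x n)⟫_ℂ := by
        conv_lhs => rw [← hx n]
        rw [inner_add_right, inner_smul_right]
      rw [l, r, sa_sym A hA]
    have e4 : ⟪ψ, Hop (x n)⟫_ℂ = ⟪(y n : E), Hop ψ⟫_ℂ := by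
      rw [← hH, hψ, inner_smul_left, inner_smul_right, e3]; simp
    have e5 := hD (y n) (x n)
    rw [← e5]
    refine (mul_eq_zero.1 (?_ : (Complex.I * t n : ℂ) * _ = 0)).resolve_left ha
    rw [mul_sub, e1, e2, e4, sub_self]
  have hlim : Tendsto (fun n => ⟪(y n : E), D (x n)⟫_ℂ) atTop (𝓝 ⟪ψ, D ψ⟫_ℂ) :=
    hyl.inner ((D.continuous.tendsto ψ).comp hxl)
  simp only [hz] at hlim
  exact tendsto_nhds_unique hlim tendsto_const_nhds |>.symm ▸ rfl

theorem compact_seq (K : E →L[ℂ] E) (hK : IsCompactOperator ⇑K) (f : ℕ → E)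
    (hf : Orthonormal ℂ f) (c : ℝ) (hc : 0 < c) (h : ∀ n, (⟪f n, K (f n)⟫_ℂ).re ≤ -c) :
    False := by
  have hcomp := IsCompactOperator.isCompact_closure_image_closedBall
    (f := (K : E →ₗ[ℂ] E)) hK 1
  obtain ⟨z, -, φ, hφ, hlim⟩ := hcomp.tendsto_subseq (x := fun n => K (f n)) (fun n =>
    subset_closure ⟨f n, by simp [hf.1 n], rfl⟩)
  have hw : Tendsto (fun n => ⟪f n, z⟫_ℂ) atTop (𝓝 0) := by
    have h1 := (hf.inner_products_summable z).tendsto_atTop_zero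
    have h2 := h1.sqrt
    rw [tendsto_zero_iff_norm_tendsto_zero]
    simpa [Real.sqrt_sq] using h2
  have hw' := hw.comp hφ.tendsto_atTop
  have h3 : Tendsto (fun n => ⟪f (φ n), K (f (φ n)) - z⟫_ℂ) atTop (𝓝 0) := by
    have h4 : Tendsto (fun n => ‖K (f (φ n)) - z‖) atTop (𝓝 0) :=
      tendsto_iff_norm_sub_tendsto_zero.1 hlim
    refine squeeze_zero_norm (fun n => ?_) h4
    have := norm_inner_le_norm (𝕜 := ℂ) (f (φ n)) (K (f (φ n)) - z)
    rwa [hf.1, one_mul] at this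
  have h5 := (Complex.continuous_re.tendsto _).comp (h3.add hw')
  have h6 : (0 + 0 : ℂ).re ≤ -c := by
    refine le_of_tendsto' h5 fun n => ?_
    have := h (φ n)
    simpa [inner_sub_right] using this
  simp at h6
  linarith

theorem extend_orth (Hop : E →L[ℂ] E) (hsa : IsSelfAdjoint Hop) (Λ : Set ℝ)
    (hinf : ¬ FiniteDimensional ℂ
      ↥(⨆ μ ∈ Λ, Module.End.eigenspace (↑Hop : E →ₗ[ℂ] E) ((μ : ℝ) : ℂ)))
    (s : Finset E) (hs : ∀ x ∈ s, ‖x‖ = 1 ∧ ∃ μ ∈ Λ, Hop x = ((μ : ℝ) : ℂ) • x) :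
    ∃ y, (‖y‖ = 1 ∧ ∃ μ ∈ Λ, Hop y = ((μ : ℝ) : ℂ) • y) ∧ ∀ x ∈ s, ⟪x, y⟫_ℂ = 0 := by
  have hH : ∀ a b : E, ⟪Hop a, b⟫_ℂ = ⟪a, Hop b⟫_ℂ := fun a b => hsa.isSymmetric a b
  let W : Submodule ℂ E := Submodule.span ℂ (s : Set E)
  haveI : FiniteDimensional ℂ W := FiniteDimensional.span_finset ℂ s
  have hWinv : ∀ w ∈ W, Hop w ∈ W := by
    intro w hw
    have : W ≤ W.comap (Hop : E →ₗ[ℂ] E) := by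
      refine Submodule.span_le.2 fun x hx => ?_
      obtain ⟨-, μ, -, hμ⟩ := hs x hx
      change Hop x ∈ W
      rw [hμ]
      exact W.smul_mem _ (Submodule.subset_span hx)
    exact this hw
  have hex : ∃ μ ∈ Λ, ∃ v, Hop v = ((μ : ℝ) : ℂ) • v ∧ v ∉ W := by
    by_contra! hcon
    apply hinf
    have hle : (⨆ μ ∈ Λ, Module.End.eigenspace (↑Hop : E →ₗ[ℂ] E) ((μ : ℝ) : ℂ)) ≤ W := by
      refine iSup₂_le fun μ hμ v hv => ?_
      exact hcon μ hμ v (by simpa using Module.End.mem_eigenspace_iff.1 hv)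
    exact Submodule.finiteDimensional_of_le hle
  obtain ⟨μ, hμ, v, hv, hvW⟩ := hex
  let w : E := W.starProjection v
  have hw : w ∈ W := W.starProjection_apply_mem v
  have hvw : v - w ∈ Wᗮ := W.sub_starProjection_mem_orthogonal v
  have hne : v - w ≠ 0 := fun h0 => hvW (by rw [sub_eq_zero.1 h0]; exact hw)
  have heig : Hop (v - w) = (μ : ℂ) • (v - w) := by
    have h1 : Hop (v - w) - (μ : ℂ) • (v - w) ∈ Wᗮ := by
      refine Wᗮ.sub_mem ?_ (Wᗮ.smul_mem _ hvw)
      rw [Submodule.mem_orthogonal]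
      intro a ha
      rw [← hH]
      exact (Submodule.mem_orthogonal W _).1 hvw _ (hWinv a ha)
    have h2 : Hop (v - w) - (μ : ℂ) • (v - w) ∈ W := by
      have : Hop (v - w) - (μ : ℂ) • (v - w) = (μ : ℂ) • w - Hop w := by
        rw [map_sub, hv, smul_sub]; abel
      rw [this]
      exact W.sub_mem (W.smul_mem _ hw) (hWinv w hw)
    have h3 := (Submodule.mem_orthogonal W _).1 h1 _ h2
    exact sub_eq_zero.1 (inner_self_eq_zero.1 h3)
  refine ⟨((‖v - w‖ : ℂ)⁻¹) • (v - w), ⟨?_, μ, hμ, ?_⟩, fun x hx => ?_⟩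
  · rw [norm_smul, norm_inv, Complex.norm_real, norm_norm]
    exact inv_mul_cancel₀ (norm_ne_zero_iff.2 hne)
  · rw [map_smul, heig, smul_comm]
  · rw [inner_smul_right, (Submodule.mem_orthogonal W _).1 hvw x (Submodule.subset_span hx),
      mul_zero]

end VirialHelpers

/-- If a bounded self-adjoint `H ∈ C¹(A)` satisfies a Mourre
estimate `E_Λ(H) i[A,H] E_Λ(H) ≥ c E_Λ(H) + K` on a Borel set `Λ` (with `c > 0`,
`K` compact, `P = E_Λ(H)` the spectral projection), then `H` has only finitely
many eigenvalues in `Λ`, each of finite multiplicity: the span of the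
corresponding eigenspaces is finite dimensional. -/
theorem stmt_13 (Hop : E →L[ℂ] E) (hsa : IsSelfAdjoint Hop)
    (A : E →ₗ.[ℂ] E) (hAsa : A.adjoint = A)
    (D : E →L[ℂ] E) (hD : CommutatorOf A Hop D)
    (Λ : Set ℝ) (hΛm : MeasurableSet Λ)
    (P : E →L[ℂ] E) (hPsa : IsSelfAdjoint P) (hPP : P ∘L P = P)
    (hPH : P ∘L Hop = Hop ∘L P)
    (hPev : ∀ μ : ℝ, μ ∈ Λ → ∀ ψ : E, Hop ψ = (μ : ℂ) • ψ → P ψ = ψ)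
    (c : ℝ) (hc : 0 < c) (K : E →L[ℂ] E) (hK : IsCompactOperator ⇑K)
    (hM : ∀ ψ : E,
      (⟪P ψ, (Complex.I • D) (P ψ)⟫_ℂ).re ≥ c * ‖P ψ‖ ^ 2 + (⟪P ψ, K (P ψ)⟫_ℂ).re) :
    FiniteDimensional ℂ
      ↥(⨆ μ ∈ Λ, Module.End.eigenspace (↑Hop : E →ₗ[ℂ] E) ((μ : ℝ) : ℂ)) := by
  by_contra hinf
  obtain ⟨f, hf, hr⟩ := exists_seq_of_forall_finset_exists
    (fun x : E => ‖x‖ = 1 ∧ ∃ μ ∈ Λ, Hop x = ((μ : ℝ) : ℂ) • x)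
    (fun x y => ⟪x, y⟫_ℂ = 0) (extend_orth Hop hsa Λ hinf)
  have hon : Orthonormal ℂ f := by
    refine ⟨fun n => (hf n).1, fun m n hmn => ?_⟩
    rcases lt_or_gt_of_ne hmn with h | h
    · exact hr m n h
    · exact inner_eq_zero_symm.1 (hr n m h)
  refine compact_seq K hK f hon c hc fun n => ?_
  obtain ⟨h1, μ, hμ, he⟩ := hf n
  have hv := virial Hop hsa A hAsa D hD μ (f n) he
  have h := hM (f n)
  rw [hPev μ hμ (f n) he, h1, ContinuousLinearMap.smul_apply, inner_smul_right, hv] at h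
  simp at h
  linarith
end
end
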